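/- Let d ≥ 3 be an integer and let p > d/(d-2). Then the bilinear discrete spherical maximal operator T* is bounded from l^p(ℤ^d) × l^∞(ℤ^d) to l^p(ℤ^d): there exists a constant C = C(d,p) such that for all f ∈ l^p(ℤ^d) and g ∈ l^∞(ℤ^d), ‖T*(f,g)‖_{l^p(ℤ^d)} ≤ C ‖f‖_{l^p(ℤ^d)} ‖g‖_{l^∞(ℤ^d)}. -/

import Mathlib

open scoped ENNReal NNReal BigOperators

noncomputable section

/-- `ℤ^d` -/
abbrev V (d : ℕ) := Fin d → ℤ

/-- The sphere `{(u,v) ∈ ℤ^d × ℤ^d : |u|² + |v|² = λ}`. -/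
def sph (d lam : ℕ) : Set (V d × V d) :=
  {uv | (∑ i, uv.1 i ^ 2) + (∑ i, uv.2 i ^ 2) = (lam : ℤ)}

/-- `N(λ)`, the number of lattice points on the sphere of radius `λ^{1/2}` in `ℝ^{2d}`. -/
def Ncount (d lam : ℕ) : ℕ := Nat.card (sph d lam)

/-- The bilinear discrete spherical average `T_λ(f,g)(x)`. -/
def avg (d lam : ℕ) (f g : V d → ℂ) (x : V d) : ℂ :=
  (Ncount d lam : ℂ)⁻¹ *
    ∑' uv : sph d lam, f (x - (uv : V d × V d).1) * g (x - (uv : V d × V d).2)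

/-- The bilinear discrete spherical maximal function
`T*(f,g)(x) = sup_{λ ∈ ℕ, N(λ) > 0} |T_λ(f,g)(x)|`. -/
def maxOp (d : ℕ) (f g : V d → ℂ) (x : V d) : ℝ≥0∞ :=
  ⨆ (lam : ℕ) (_ : 0 < Ncount d lam), (‖avg d lam f g x‖₊ : ℝ≥0∞)

/-- The `l^p(ℤ^d)` norm of a complex-valued function. -/
def lpNorm (d : ℕ) (p : ℝ) (f : V d → ℂ) : ℝ≥0∞ :=
  (∑' x : V d, (‖f x‖₊ : ℝ≥0∞) ^ p) ^ (1 / p)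

/-- The `l^p(ℤ^d)` norm of an `ℝ≥0∞`-valued function. -/
def lpNormE (d : ℕ) (p : ℝ) (F : V d → ℝ≥0∞) : ℝ≥0∞ :=
  (∑' x : V d, F x ^ p) ^ (1 / p)

/-- The `l^∞(ℤ^d)` norm. -/
def linftyNorm (d : ℕ) (f : V d → ℂ) : ℝ≥0∞ :=
  ⨆ x : V d, (‖f x‖₊ : ℝ≥0∞)

namespace BilinearSpherical
open Finset

/-- The divisor sum `∑_{e ∣ n} χ₄(e)`. -/
def chiSum (n : ℕ) : ℤ := ∑ e ∈ n.divisors, ZMod.χ₄ (e : ZMod 4)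

lemma chiSum_prime_mul_add {p m : ℕ} (hp : p.Prime) (hm : m ≠ 0) :
    chiSum (p * m) + ZMod.χ₄ (p : ZMod 4) * ∑ e ∈ m.divisors with p * e ∣ m, ZMod.χ₄ (e : ZMod 4)
      = (1 + ZMod.χ₄ (p : ZMod 4)) * chiSum m := by
  classical
  have hinj : Set.InjOn (fun e : ℕ => p * e) (m.divisors : Set ℕ) :=
    fun a _ b _ h => Nat.eq_of_mul_eq_mul_left hp.pos h
  have hU : (p * m).divisors = m.divisors ∪ m.divisors.image (fun e => p * e) := by
    ext e
    simp only [Nat.mem_divisors, mem_union, mem_image, ne_eq, mul_eq_zero, hp.ne_zero, hm,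
      or_self, not_false_eq_true, and_true]
    constructor
    · intro h
      by_cases hpe : p ∣ e
      · obtain ⟨c, rfl⟩ := hpe
        exact Or.inr ⟨c, Nat.dvd_of_mul_dvd_mul_left hp.pos h, rfl⟩
      · exact Or.inl (((hp.coprime_iff_not_dvd.2 hpe).symm).dvd_of_dvd_mul_left h)
    · rintro (h | ⟨c, h, rfl⟩)
      · exact h.mul_left p
      · exact Nat.mul_dvd_mul_left p h
  have hI : m.divisors ∩ m.divisors.image (fun e => p * e)
      = (m.divisors.filter (fun e => p * e ∣ m)).image (fun e => p * e) := by
    ext e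
    simp only [mem_inter, Nat.mem_divisors, mem_image, mem_filter]
    constructor
    · rintro ⟨h, c, hc, rfl⟩
      exact ⟨c, ⟨hc, h.1⟩, rfl⟩
    · rintro ⟨c, ⟨hc, h⟩, rfl⟩
      exact ⟨⟨h, hc.2⟩, c, hc, rfl⟩
  have key := sum_union_inter (s₁ := m.divisors) (s₂ := m.divisors.image (fun e => p * e))
    (f := fun e : ℕ => ZMod.χ₄ (e : ZMod 4))
  rw [← hU, hI, sum_image hinj, sum_image (hinj.mono (by simp [Set.subset_def]; tauto))] at key
  simp only [Nat.cast_mul, map_mul, ← mul_sum] at key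
  unfold chiSum
  linarith

lemma chiSum_prime_mul {p m : ℕ} (hp : p.Prime) (hm : ¬ p ∣ m) :
    chiSum (p * m) = (1 + ZMod.χ₄ (p : ZMod 4)) * chiSum m := by
  have hm0 : m ≠ 0 := by rintro rfl; simp at hm
  rw [← chiSum_prime_mul_add hp hm0, filter_false_of_mem, sum_empty, mul_zero, add_zero]
  exact fun e _ h => hm (dvd_of_mul_right_dvd h)

lemma chiSum_prime_sq_mul {p k : ℕ} (hp : p.Prime) (hk : k ≠ 0) :
    chiSum (p * (p * k)) + ZMod.χ₄ (p : ZMod 4) * chiSum k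
      = (1 + ZMod.χ₄ (p : ZMod 4)) * chiSum (p * k) := by
  rw [← chiSum_prime_mul_add hp (mul_ne_zero hp.ne_zero hk)]
  congr 2
  unfold chiSum
  congr 1
  ext e
  simp only [Nat.mem_divisors, mem_filter]
  constructor
  · rintro ⟨h, _⟩
    exact ⟨⟨h.mul_left p, mul_ne_zero hp.ne_zero hk⟩, Nat.mul_dvd_mul_left p h⟩
  · rintro ⟨_, h⟩
    exact ⟨Nat.dvd_of_mul_dvd_mul_left hp.pos h, hk⟩

/-- The Gaussian integers of norm `n`. -/
def gaussNorm (n : ℕ) : Set GaussianInt := {z | z.norm = n}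

lemma gaussNorm_finite (n : ℕ) : (gaussNorm n).Finite := by
  have : Set.Finite ((Set.Icc (-(n : ℤ)) n) ×ˢ (Set.Icc (-(n : ℤ)) n)) :=
    (Set.finite_Icc _ _).prod (Set.finite_Icc _ _)
  refine Set.Finite.of_finite_image (f := fun z : GaussianInt => (z.re, z.im)) (this.subset ?_) ?_
  · rintro _ ⟨z, hz, rfl⟩
    simp only [gaussNorm, Set.mem_ofPred_eq, Zsqrtd.norm_def] at hz
    simp only [Set.mem_prod, Set.mem_Icc]
    refine ⟨⟨?_, ?_⟩, ?_, ?_⟩ <;> nlinarith [sq_nonneg z.re, sq_nonneg z.im]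
  · intro a _ b _ h
    simp only [Prod.mk.injEq] at h
    exact Zsqrtd.ext h.1 h.2

lemma mul_image_gaussNorm_ncard {w : GaussianInt} (hw : w ≠ 0) (m : ℕ) :
    ((fun z => w * z) '' gaussNorm m).ncard = (gaussNorm m).ncard :=
  Set.ncard_image_of_injective _ (mul_right_injective₀ hw)

lemma norm_natCast_ne {p : ℕ} (hp : p ≠ 0) : (p : GaussianInt) ≠ 0 := by exact_mod_cast hp

/-- For an inert prime `p`, every `z` with `p ∣ norm z` is a multiple of `p`. -/
lemma gaussNorm_inert {p : ℕ} (hp : p.Prime) (h3 : p % 4 = 3) (m : ℕ) :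
    gaussNorm (p * m) = (fun z => (p : GaussianInt) * z) '' {z | (p : ℤ) * z.norm = m} := by
  have := Fact.mk hp
  have hpr := GaussianInt.prime_of_nat_prime_of_mod_four_eq_three p h3
  have hp0 : (p : ℤ) ≠ 0 := by exact_mod_cast hp.ne_zero
  ext z
  simp only [gaussNorm, Set.mem_ofPred_eq, Set.mem_image]
  constructor
  · intro hz
    have h1 : (p : GaussianInt) ∣ z * star z := by
      rw [← Zsqrtd.norm_eq_mul_conj, hz]
      push_cast
      exact dvd_mul_right _ _
    have h2 : (p : GaussianInt) ∣ z := by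
      rcases hpr.dvd_or_dvd h1 with h | ⟨w, h⟩
      · exact h
      · refine ⟨star w, ?_⟩
        have := congrArg star h
        rw [star_star] at this
        rw [this, star_mul, mul_comm]
        simp
    obtain ⟨w, rfl⟩ := h2
    refine ⟨w, ?_, rfl⟩
    rw [Zsqrtd.norm_mul, Zsqrtd.norm_natCast] at hz
    push_cast at hz
    rw [mul_assoc] at hz
    exact mul_left_cancel₀ hp0 hz
  · rintro ⟨w, hw, rfl⟩
    rw [Zsqrtd.norm_mul, Zsqrtd.norm_natCast, mul_assoc, hw]
    push_cast; rfl

/-- For a split prime `p = π * star π`, the elements of norm `p * m` are the multiples of `π`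
and those of `star π`; the common ones are the multiples of `p`. -/
lemma gaussNorm_split {p : ℕ} (hp : p.Prime) (h1 : p % 4 = 1) :
    ∃ a : GaussianInt, a ≠ 0 ∧ star a ≠ 0 ∧ ∀ m : ℕ,
      gaussNorm (p * m) = (fun z => a * z) '' gaussNorm m ∪ (fun z => star a * z) '' gaussNorm m ∧
      (fun z => a * z) '' gaussNorm m ∩ (fun z => star a * z) '' gaussNorm m
        = (fun z => (p : GaussianInt) * z) '' {z | (p : ℤ) * z.norm = m} := by
  have := Fact.mk hp
  obtain ⟨x, y, hxy⟩ := Nat.Prime.sq_add_sq (p := p) (by omega)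
  have hp0 : (p : ℤ) ≠ 0 := by exact_mod_cast hp.ne_zero
  set a : GaussianInt := ⟨x, y⟩ with ha
  have hna : a.norm = p := by
    rw [Zsqrtd.norm_def, ← hxy]; simp [ha]; ring
  have hna' : (star a).norm = p := by rw [Zsqrtd.norm_conj, hna]
  have ha0 : a ≠ 0 := by
    intro h; rw [h, Zsqrtd.norm_zero] at hna; exact hp0 hna.symm
  have ha0' : star a ≠ 0 := by
    intro h; rw [h, Zsqrtd.norm_zero] at hna'; exact hp0 hna'.symm
  have hirr : ∀ b : GaussianInt, b.norm = p → Prime b := by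
    intro b hb
    rw [← irreducible_iff_prime]
    refine ⟨fun hu => ?_, fun u v huv => ?_⟩
    · rw [Zsqrtd.isUnit_iff_norm_isUnit, hb, Int.isUnit_iff] at hu
      have := hp.two_le; omega
    · have h := congrArg Zsqrtd.norm huv
      rw [hb, Zsqrtd.norm_mul] at h
      have hpi : Irreducible (p : ℤ) := (Nat.prime_iff_prime_int.1 hp).irreducible
      rw [Zsqrtd.isUnit_iff_norm_isUnit, Zsqrtd.isUnit_iff_norm_isUnit]
      exact hpi.isUnit_or_isUnit h
  have hmul : a * star a = (p : GaussianInt) := by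
    rw [← Zsqrtd.norm_eq_mul_conj, hna]; simp
  have hnd : ¬ a ∣ star a := by
    intro h
    have h2 : a ∣ ((2 * x : ℤ) : GaussianInt) := by
      have : a + star a = ((2 * x : ℤ) : GaussianInt) := by
        refine Zsqrtd.ext ?_ ?_ <;> simp [ha]; ring
      rw [← this]
      exact dvd_add dvd_rfl h
    obtain ⟨c, hc⟩ := h2
    have h3 := congrArg Zsqrtd.norm hc
    rw [Zsqrtd.norm_mul, hna, Zsqrtd.norm_intCast] at h3
    have h4 : (p : ℤ) ∣ (2 * x) * (2 * x) := ⟨_, h3⟩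
    have h5 : p ∣ (2 * x) * (2 * x) := by exact_mod_cast h4
    have h6 : p ∣ 2 * x := by rcases hp.dvd_mul.1 h5 with h | h <;> exact h
    have h7 : p ∣ x := by
      rcases hp.dvd_mul.1 h6 with h | h
      · have := Nat.le_of_dvd (by norm_num) h
        have := hp.two_le
        omega
      · exact h
    have hx0 : x ≠ 0 := by
      rintro rfl
      have : p ∣ y := hp.dvd_of_dvd_pow (n := 2) (by rw [← hxy]; simp)
      obtain ⟨c, rfl⟩ := this
      have := hp.two_le
      have hc : c ≠ 0 := by rintro rfl; simp at hxy; omega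
      have : 1 ≤ c := Nat.one_le_iff_ne_zero.2 hc
      have : p * 1 ≤ p * c := Nat.mul_le_mul_left p this
      nlinarith
    have h8 := Nat.le_of_dvd (Nat.pos_of_ne_zero hx0) h7
    have := hp.two_le
    nlinarith
  have hpa := hirr a hna
  refine ⟨a, ha0, ha0', fun m => ⟨?_, ?_⟩⟩
  · ext z
    simp only [gaussNorm, Set.mem_ofPred_eq, Set.mem_image, Set.mem_union]
    constructor
    · intro hz
      have hd : a ∣ z * star z := by
        rw [← Zsqrtd.norm_eq_mul_conj, hz]
        push_cast
        rw [← hmul, mul_assoc]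
        exact dvd_mul_right _ _
      rcases hpa.dvd_or_dvd hd with ⟨w, rfl⟩ | ⟨w, h⟩
      · refine Or.inl ⟨w, ?_, rfl⟩
        rw [Zsqrtd.norm_mul, hna] at hz
        push_cast at hz
        exact mul_left_cancel₀ hp0 hz
      · have hzw : z = star a * star w := by
          have := congrArg star h
          rwa [star_star, star_mul, mul_comm] at this
        subst hzw
        refine Or.inr ⟨star w, ?_, rfl⟩
        rw [Zsqrtd.norm_mul, hna'] at hz
        push_cast at hz
        exact mul_left_cancel₀ hp0 hz
    · rintro (⟨w, hw, rfl⟩ | ⟨w, hw, rfl⟩)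
      · rw [Zsqrtd.norm_mul, hna, hw]; push_cast; rfl
      · rw [Zsqrtd.norm_mul, hna', hw]; push_cast; rfl
  · ext z
    simp only [gaussNorm, Set.mem_ofPred_eq, Set.mem_image, Set.mem_inter_iff]
    constructor
    · rintro ⟨⟨w, hw, rfl⟩, v, hv, hvw⟩
      have hd : a ∣ star a * v := ⟨w, hvw⟩
      rcases hpa.dvd_or_dvd hd with h | ⟨u, rfl⟩
      · exact absurd h hnd
      · refine ⟨u, ?_, ?_⟩
        · rw [← hna, ← Zsqrtd.norm_mul, hv]
        · rw [← hvw, ← hmul]; ring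
    · rintro ⟨u, hu, rfl⟩
      refine ⟨⟨star a * u, ?_, ?_⟩, a * u, ?_, ?_⟩
      · rw [Zsqrtd.norm_mul, hna', hu]
      · rw [← hmul]; ring
      · rw [Zsqrtd.norm_mul, hna, hu]
      · rw [← hmul]; ring

lemma gaussNorm_one_ncard : (gaussNorm 1).ncard = 4 := by
  have : gaussNorm 1 = {1, -1, ⟨0, 1⟩, ⟨0, -1⟩} := by
    ext z
    simp only [gaussNorm, Set.mem_ofPred_eq, Set.mem_insert_iff, Set.mem_singleton_iff,
      Zsqrtd.norm_def, Zsqrtd.ext_iff]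
    simp
    constructor
    · intro h
      have h1 : z.re ≤ 1 := by nlinarith [sq_nonneg z.im]
      have h2 : -1 ≤ z.re := by nlinarith [sq_nonneg z.im]
      have h3 : z.im ≤ 1 := by nlinarith [sq_nonneg z.re]
      have h4 : -1 ≤ z.im := by nlinarith [sq_nonneg z.re]
      generalize z.re = a at *
      generalize z.im = b at *
      interval_cases a <;> interval_cases b <;> simp_all
    · rintro (⟨h, h'⟩ | ⟨h, h'⟩ | ⟨h, h'⟩ | ⟨h, h'⟩) <;> simp [h, h']
  rw [this]
  have e : ({1, -1, ⟨0, 1⟩, ⟨0, -1⟩} : Set GaussianInt)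
      = (({1, -1, ⟨0, 1⟩, ⟨0, -1⟩} : Finset GaussianInt) : Set GaussianInt) := by simp
  rw [e, Set.ncard_coe_finset]
  decide

lemma gaussNorm_prime_mul_ncard {p : ℕ} (hp : p.Prime) (h2 : p ≠ 2) (m : ℕ) :
    ((gaussNorm (p * m)).ncard : ℤ)
        + ZMod.χ₄ (p : ZMod 4) * ({z : GaussianInt | (p : ℤ) * z.norm = m}.ncard : ℤ)
      = (1 + ZMod.χ₄ (p : ZMod 4)) * ((gaussNorm m).ncard : ℤ) := by
  have hpi : ((fun z => (p : GaussianInt) * z) '' {z : GaussianInt | (p : ℤ) * z.norm = m}).ncard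
      = {z : GaussianInt | (p : ℤ) * z.norm = m}.ncard :=
    Set.ncard_image_of_injective _ (mul_right_injective₀ (norm_natCast_ne hp.ne_zero))
  have hodd := hp.eq_two_or_odd
  rcases (by omega : p % 4 = 1 ∨ p % 4 = 3) with h | h
  · obtain ⟨a, ha, ha', H⟩ := gaussNorm_split hp h
    have key := Set.ncard_union_add_ncard_inter ((fun z => a * z) '' gaussNorm m)
      ((fun z => star a * z) '' gaussNorm m) ((gaussNorm_finite m).image _)
      ((gaussNorm_finite m).image _)
    rw [← (H m).1, (H m).2, hpi, mul_image_gaussNorm_ncard ha, mul_image_gaussNorm_ncard ha'] at key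
    rw [ZMod.χ₄_nat_one_mod_four h]
    push_cast [← @Nat.cast_inj ℤ] at key
    linarith
  · rw [ZMod.χ₄_nat_three_mod_four h, gaussNorm_inert hp h, hpi]
    ring

/-- Jacobi's two-square theorem for odd numbers. -/
theorem gaussNorm_ncard (n : ℕ) (hn : Odd n) : ((gaussNorm n).ncard : ℤ) = 4 * chiSum n := by
  induction n using Nat.strong_induction_on with
  | _ n ih =>
    by_cases h1 : n = 1
    · subst h1
      rw [gaussNorm_one_ncard]; simp [chiSum]
    · obtain ⟨p, hp, m, rfl⟩ := Nat.exists_prime_and_dvd h1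
      have hpo := (Nat.odd_mul.1 hn).1
      have hmo := (Nat.odd_mul.1 hn).2
      have h2 : p ≠ 2 := by rintro rfl; exact absurd hpo (by decide)
      have hm0 : 0 < m := hmo.pos
      have hmlt : m < p * m := by nlinarith [hp.two_le]
      have hrec := gaussNorm_prime_mul_ncard hp h2 m
      rw [ih m hmlt hmo] at hrec
      have hp0 : (p : ℤ) ≠ 0 := by exact_mod_cast hp.ne_zero
      by_cases hd : p ∣ m
      · obtain ⟨k, rfl⟩ := hd
        have hko := (Nat.odd_mul.1 hmo).2
        have e : {z : GaussianInt | (p : ℤ) * z.norm = (p * k : ℕ)} = gaussNorm k := by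
          ext z
          simp only [gaussNorm, Set.mem_ofPred_eq]
          push_cast
          exact mul_right_inj' hp0
        rw [e, ih k (by nlinarith [hp.two_le, hko.pos]) hko] at hrec
        have := chiSum_prime_sq_mul hp hko.pos.ne'
        linear_combination hrec - 4 * this
      · have e : {z : GaussianInt | (p : ℤ) * z.norm = m} = ∅ := by
          ext z
          simp only [Set.mem_ofPred_eq, Set.mem_empty_iff_false, iff_false]
          intro h
          exact hd (Int.natCast_dvd_natCast.1 ⟨_, h.symm⟩)
        rw [e] at hrec
        have := chiSum_prime_mul hp hd
        rw [Set.ncard_empty, Nat.cast_zero, mul_zero, add_zero] at hrec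
        linear_combination hrec - 4 * this

/-- Quadruples `((d, a), (e, b))` of odd numbers with `d * a + e * b = 2 * n`. -/
def oddQuads (n : ℕ) : Finset ((ℕ × ℕ) × (ℕ × ℕ)) :=
  ((range (2 * n + 1) ×ˢ range (2 * n + 1)) ×ˢ (range (2 * n + 1) ×ˢ range (2 * n + 1))).filter
    fun q => Odd q.1.1 ∧ Odd q.1.2 ∧ Odd q.2.1 ∧ Odd q.2.2 ∧
      q.1.1 * q.1.2 + q.2.1 * q.2.2 = 2 * n

lemma mem_oddQuads {n : ℕ} {q : (ℕ × ℕ) × (ℕ × ℕ)} : q ∈ oddQuads n ↔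
    Odd q.1.1 ∧ Odd q.1.2 ∧ Odd q.2.1 ∧ Odd q.2.2 ∧
      q.1.1 * q.1.2 + q.2.1 * q.2.2 = 2 * n := by
  simp only [oddQuads, mem_filter, mem_product, mem_range, and_iff_right_iff_imp]
  rintro ⟨h1, h2, h3, h4, h⟩
  have := h1.pos
  have := h2.pos
  have := h3.pos
  have := h4.pos
  refine ⟨⟨?_, ?_⟩, ?_, ?_⟩ <;> nlinarith

/-- The sign `χ₄(d) χ₄(e)` of a quadruple. -/
def quadSign (q : (ℕ × ℕ) × (ℕ × ℕ)) : ℤ :=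
  ZMod.χ₄ (q.1.1 : ZMod 4) * ZMod.χ₄ (q.2.1 : ZMod 4)

lemma sum_chiSum_mul_chiSum (n : ℕ) :
    ∑ x ∈ antidiagonal (2 * n) with Odd x.1 ∧ Odd x.2, chiSum x.1 * chiSum x.2
      = ∑ q ∈ oddQuads n, quadSign q := by
  rw [← sum_fiberwise_of_maps_to (t := (antidiagonal (2 * n)).filter fun x => Odd x.1 ∧ Odd x.2)
    (g := fun q : (ℕ × ℕ) × (ℕ × ℕ) => (q.1.1 * q.1.2, q.2.1 * q.2.2))]
  · refine sum_congr rfl fun x hx => ?_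
    rw [mem_filter, HasAntidiagonal.mem_antidiagonal] at hx
    have e : (oddQuads n).filter (fun q => (q.1.1 * q.1.2, q.2.1 * q.2.2) = x)
        = x.1.divisorsAntidiagonal ×ˢ x.2.divisorsAntidiagonal := by
      ext q
      simp only [mem_filter, mem_oddQuads, mem_product, Nat.mem_divisorsAntidiagonal]
      constructor
      · rintro ⟨_, rfl⟩
        exact ⟨⟨rfl, hx.2.1.pos.ne'⟩, rfl, hx.2.2.pos.ne'⟩
      · rintro ⟨⟨h1, _⟩, h2, _⟩
        have o1 := Nat.odd_mul.1 (h1 ▸ hx.2.1)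
        have o2 := Nat.odd_mul.1 (h2 ▸ hx.2.2)
        exact ⟨⟨o1.1, o1.2, o2.1, o2.2, by rw [h1, h2]; exact hx.1⟩, by rw [h1, h2]⟩
    rw [e, sum_product]
    unfold chiSum quadSign
    have hdiv : ∀ m : ℕ, ∑ e ∈ m.divisors, ZMod.χ₄ (e : ZMod 4)
        = ∑ y ∈ m.divisorsAntidiagonal, ZMod.χ₄ (y.1 : ZMod 4) := fun m =>
      (Nat.sum_divisorsAntidiagonal (fun e _ : ℕ => ZMod.χ₄ (e : ZMod 4))).symm
    rw [hdiv, hdiv, sum_mul_sum]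
  · intro q hq
    rw [mem_oddQuads] at hq
    rw [mem_filter, HasAntidiagonal.mem_antidiagonal]
    exact ⟨hq.2.2.2.2, hq.1.mul hq.2.1, hq.2.2.1.mul hq.2.2.2.1⟩

/-- Dirichlet's involution on quadruples with `e < d`. -/
def quadFlip (q : (ℕ × ℕ) × (ℕ × ℕ)) : (ℕ × ℕ) × (ℕ × ℕ) :=
  let s := q.1.1 - q.2.1
  let w := q.1.2 + q.2.2
  let j := q.1.1 / s
  ((q.1.2 + j * w, q.1.1 % s), (j * w - q.2.2, s - q.1.1 % s))

lemma chi_mul_chi_of_odd {d e : ℕ} (hd : Odd d) (he : Odd e) :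
    ZMod.χ₄ (d : ZMod 4) * ZMod.χ₄ (e : ZMod 4) = if d % 4 = e % 4 then 1 else -1 := by
  rw [ZMod.χ₄_nat_eq_if_mod_four, ZMod.χ₄_nat_eq_if_mod_four]
  rw [Nat.odd_iff] at hd he
  have h1 : d % 4 = 1 ∨ d % 4 = 3 := by omega
  have h2 : e % 4 = 1 ∨ e % 4 = 3 := by omega
  have h3 : ¬ d % 2 = 0 := by omega
  have h4 : ¬ e % 2 = 0 := by omega
  rcases h1 with h1 | h1 <;> rcases h2 with h2 | h2 <;> simp [h1, h2, h3, h4]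

lemma quadFlip_spec {n : ℕ} (hn : Odd n) {q : (ℕ × ℕ) × (ℕ × ℕ)} (hq : q ∈ oddQuads n)
    (hlt : q.2.1 < q.1.1) :
    quadFlip q ∈ oddQuads n ∧ (quadFlip q).2.1 < (quadFlip q).1.1 ∧
      quadFlip (quadFlip q) = q ∧ quadSign q + quadSign (quadFlip q) = 0 := by
  obtain ⟨⟨d, a⟩, e, b⟩ := q
  rw [mem_oddQuads] at hq
  simp only at hq hlt
  obtain ⟨hd, ha, he, hb, h⟩ := hq
  obtain ⟨s, rfl⟩ : ∃ s, d = e + s := ⟨d - e, by omega⟩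
  have hs : 0 < s := by omega
  have hse : s % 2 = 0 := by rw [Nat.odd_iff] at hd he; omega
  have hj1 : 1 ≤ (e + s) / s := (Nat.one_le_div_iff hs).2 (by omega)
  have hdiv := Nat.div_add_mod (e + s) s
  have hmod := Nat.mod_lt (e + s) hs
  set j := (e + s) / s with hj
  set r := (e + s) % s with hr
  have hro : Odd r := by
    have : Odd (s * j + r) := hdiv ▸ hd
    rw [Nat.odd_add] at this
    by_contra hc
    rw [Nat.not_odd_iff_even] at hc
    have h1 := this.2 hc
    have h2 : Even (s * j) := (Nat.even_iff.2 hse).mul_right j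
    exact (Nat.not_odd_iff_even.2 h2) h1
  have hb0 := hb.pos
  have ha0 := ha.pos
  have hw : (a + b) % 2 = 0 := by rw [Nat.odd_iff] at ha hb; omega
  obtain ⟨c, hc⟩ : ∃ c, j * (a + b) = b + c := ⟨j * (a + b) - b, by
    have : 1 * (a + b) ≤ j * (a + b) := Nat.mul_le_mul_right _ hj1
    omega⟩
  obtain ⟨t, ht⟩ : ∃ t, s = r + t := ⟨s - r, by omega⟩
  have hflip : quadFlip ((e + s, a), (e, b)) = ((a + (b + c), r), (c, t)) := by
    simp only [quadFlip, Nat.add_sub_cancel_left, ← hj, ← hr, hc]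
    simp only [Prod.mk.injEq, true_and]
    omega
  have hjw : (j * (a + b)) % 2 = 0 := by
    rw [Nat.mul_mod, hw]; simp
  have hco : Odd c := by
    rw [Nat.odd_iff] at hb ⊢; omega
  have hto : Odd t := by
    rw [Nat.odd_iff] at hro ⊢; omega
  have hsum : (a + (b + c)) * r + c * t = 2 * n := by
    rw [← h]
    have e1 : (e : ℤ) = s * j + r - s := by
      have : ((s * j + r : ℕ) : ℤ) = ((e + s : ℕ) : ℤ) := by rw [hdiv]
      push_cast at this; linarith
    have e2 : (c : ℤ) = j * (a + b) - b := by
      have : ((j * (a + b) : ℕ) : ℤ) = ((b + c : ℕ) : ℤ) := by rw [hc]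
      push_cast at this; linarith
    have e3 : (t : ℤ) = s - r := by rw [ht]; push_cast; ring
    zify
    rw [e1, e2, e3]; ring
  have ho1 : Odd (a + (b + c)) := by
    rw [Nat.odd_iff] at ha hb hco ⊢; omega
  rw [hflip]
  refine ⟨mem_oddQuads.2 ⟨ho1, hro, hco, hto, hsum⟩, by simp only; omega, ?_, ?_⟩
  · have hdw : a + (b + c) - c = a + b := by omega
    have hq1 : (a + (b + c)) / (a + b) = j := by
      rw [← hc, Nat.add_mul_div_right _ _ (by omega), Nat.div_eq_of_lt (by omega), zero_add]
    have hq2 : (a + (b + c)) % (a + b) = a := by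
      rw [← hc, Nat.add_mul_mod_self_right, Nat.mod_eq_of_lt (by omega)]
    simp only [quadFlip, hdw, hq1, hq2]
    have h1 : r + j * (r + t) = e + s := by rw [← ht, ← hdiv]; ring
    have h2 : j * (r + t) - t = e := by omega
    rw [h1, h2]
    simp
  · unfold quadSign
    simp only
    rw [chi_mul_chi_of_odd hd he, chi_mul_chi_of_odd ho1 hco]
    have key : ¬ (s % 4 = 0 ↔ (a + b) % 4 = 0) := by
      obtain ⟨u, rfl⟩ : ∃ u, s = 2 * u := ⟨s / 2, by omega⟩
      obtain ⟨v, hv⟩ : ∃ v, a + b = 2 * v := ⟨(a + b) / 2, by omega⟩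
      have h' : e * v + u * a = n := by
        have : 2 * (e * v + u * a) = 2 * n := by
          rw [← h]
          calc 2 * (e * v + u * a) = e * (2 * v) + 2 * u * a := by ring
            _ = _ := by rw [← hv]; ring
        omega
      have ho : Odd (e * v + u * a) := h' ▸ hn
      rw [Nat.odd_add, Nat.odd_mul, Nat.even_mul] at ho
      have hna : ¬ Even a := Nat.not_even_iff_odd.2 ha
      simp only [he, true_and, hna, or_false] at ho
      rw [Nat.odd_iff, Nat.even_iff] at ho
      omega
    by_cases h1 : (e + s) % 4 = e % 4 <;> by_cases h2 : (a + (b + c)) % 4 = c % 4 <;>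
      simp only [h1, h2, if_true, if_false] <;> omega

lemma sum_quadSign_lt {n : ℕ} (hn : Odd n) :
    ∑ q ∈ oddQuads n with q.2.1 < q.1.1, quadSign q = 0 := by
  refine sum_involution (fun q _ => quadFlip q) ?_ ?_ ?_ ?_
  · intro q hq
    rw [mem_filter] at hq
    exact (quadFlip_spec hn hq.1 hq.2).2.2.2
  · intro q hq hne heq
    rw [mem_filter] at hq
    have := (quadFlip_spec hn hq.1 hq.2).2.2.2
    rw [heq] at this
    omega
  · intro q hq
    rw [mem_filter] at hq ⊢
    exact ⟨(quadFlip_spec hn hq.1 hq.2).1, (quadFlip_spec hn hq.1 hq.2).2.1⟩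
  · intro q hq
    rw [mem_filter] at hq
    exact (quadFlip_spec hn hq.1 hq.2).2.2.1

lemma sum_quadSign_gt {n : ℕ} (hn : Odd n) :
    ∑ q ∈ oddQuads n with q.1.1 < q.2.1, quadSign q = 0 := by
  rw [← sum_quadSign_lt hn]
  refine sum_nbij' Prod.swap Prod.swap ?_ ?_ ?_ ?_ ?_
  · intro q hq
    simp only [mem_filter, mem_oddQuads, Prod.fst_swap, Prod.snd_swap] at hq ⊢
    obtain ⟨⟨h1, h2, h3, h4, h⟩, hlt⟩ := hq
    exact ⟨⟨h3, h4, h1, h2, by linarith⟩, hlt⟩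
  · intro q hq
    simp only [mem_filter, mem_oddQuads, Prod.fst_swap, Prod.snd_swap] at hq ⊢
    obtain ⟨⟨h1, h2, h3, h4, h⟩, hlt⟩ := hq
    exact ⟨⟨h3, h4, h1, h2, by linarith⟩, hlt⟩
  · intro q _; simp
  · intro q _; simp
  · intro q _; simp [quadSign, mul_comm]

lemma le_sum_quadSign {n : ℕ} (hn : Odd n) : (n : ℤ) ≤ ∑ q ∈ oddQuads n, quadSign q := by
  have h1 := sum_filter_add_sum_filter_not (oddQuads n) (fun q => q.2.1 < q.1.1) quadSign
  have h2 := sum_filter_add_sum_filter_not ((oddQuads n).filter (fun q => ¬ q.2.1 < q.1.1))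
    (fun q => q.1.1 < q.2.1) quadSign
  have h3 : ((oddQuads n).filter (fun q => ¬ q.2.1 < q.1.1)).filter (fun q => q.1.1 < q.2.1)
      = (oddQuads n).filter (fun q => q.1.1 < q.2.1) := by
    ext q; simp only [mem_filter]; constructor
    · rintro ⟨⟨h, _⟩, h'⟩; exact ⟨h, h'⟩
    · rintro ⟨h, h'⟩; exact ⟨⟨h, by omega⟩, h'⟩
  rw [h3, sum_quadSign_gt hn, zero_add] at h2
  rw [sum_quadSign_lt hn, zero_add, ← h2] at h1
  rw [← h1]
  set D := ((oddQuads n).filter (fun q => ¬ q.2.1 < q.1.1)).filter (fun q => ¬ q.1.1 < q.2.1)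
    with hD
  have hone : ∀ q ∈ D, quadSign q = 1 := by
    intro q hq
    simp only [hD, mem_filter, mem_oddQuads] at hq
    obtain ⟨⟨⟨o1, _, o2, _⟩, h4⟩, h5⟩ := hq
    have : q.1.1 = q.2.1 := by omega
    unfold quadSign
    rw [chi_mul_chi_of_odd o1 o2, this, if_pos rfl]
  rw [sum_congr rfl hone, sum_const, nsmul_eq_mul, mul_one]
  have hcard : (range n).card ≤ D.card := by
    refine card_le_card_of_injOn (fun i => ((1, 2 * i + 1), (1, 2 * n - (2 * i + 1)))) ?_ ?_
    · intro i hi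
      simp only [coe_range, Set.mem_Iio] at hi
      simp only [hD, mem_coe, mem_filter, mem_oddQuads]
      refine ⟨⟨⟨odd_one, ⟨i, rfl⟩, odd_one, ⟨n - i - 1, by omega⟩, by omega⟩, by omega⟩, by omega⟩
    · intro i _ k _ h
      simp only [Prod.mk.injEq] at h
      omega
  rw [card_range] at hcard
  exact_mod_cast hcard

lemma le_sum_chiSum {n : ℕ} (hn : Odd n) : (n : ℤ) ≤
    ∑ x ∈ antidiagonal (2 * n) with Odd x.1 ∧ Odd x.2, chiSum x.1 * chiSum x.2 :=
  (le_sum_quadSign hn).trans_eq (sum_chiSum_mul_chiSum n).symm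

/-- The representations of `n` as a sum of four squares. -/
def fourSq (n : ℕ) : Set (GaussianInt × GaussianInt) := {q | q.1.norm + q.2.norm = n}

lemma fourSq_finite (n : ℕ) : (fourSq n).Finite := by
  have : fourSq n ⊆ ⋃ x ∈ antidiagonal n, gaussNorm x.1 ×ˢ gaussNorm x.2 := by
    rintro ⟨z, w⟩ h
    simp only [fourSq, Set.mem_ofPred_eq] at h
    simp only [Set.mem_iUnion, HasAntidiagonal.mem_antidiagonal]
    have hz := GaussianInt.norm_nonneg z
    have hw := GaussianInt.norm_nonneg w
    refine ⟨(z.norm.toNat, w.norm.toNat), by simp only; omega, ?_⟩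
    exact Set.mk_mem_prod (Int.toNat_of_nonneg hz).symm (Int.toNat_of_nonneg hw).symm
  refine Set.Finite.subset ?_ this
  exact Set.Finite.biUnion (finite_toSet _) fun x _ =>
    (gaussNorm_finite _).prod (gaussNorm_finite _)

/-- Half of the rotation taking a representation of `2 * n` to one of `n`. -/
def halfRot (x y u v : ℤ) : GaussianInt × GaussianInt :=
  (⟨(x + u) / 2, (x - u) / 2⟩, ⟨(y + v) / 2, (y - v) / 2⟩)

lemma halfRot_mem {n : ℕ} {x y u v : ℤ} (hx : x % 2 = u % 2) (hy : y % 2 = v % 2)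
    (h : x ^ 2 + y ^ 2 + (u ^ 2 + v ^ 2) = 2 * n) : halfRot x y u v ∈ fourSq n := by
  obtain ⟨a, ha⟩ : ∃ a, x = u + 2 * a := ⟨(x - u) / 2, by omega⟩
  obtain ⟨b, hb⟩ : ∃ b, y = v + 2 * b := ⟨(y - v) / 2, by omega⟩
  subst ha hb
  have e1 : (u + 2 * a + u) / 2 = u + a := by omega
  have e2 : (u + 2 * a - u) / 2 = a := by omega
  have e3 : (v + 2 * b + v) / 2 = v + b := by omega
  have e4 : (v + 2 * b - v) / 2 = b := by omega
  simp only [fourSq, Set.mem_ofPred_eq, halfRot, Zsqrtd.norm_def, e1, e2, e3, e4]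
  nlinarith

lemma halfRot_inj {x y u v x' y' u' v' : ℤ} (hx : x % 2 = u % 2) (hy : y % 2 = v % 2)
    (hx' : x' % 2 = u' % 2) (hy' : y' % 2 = v' % 2)
    (h : halfRot x y u v = halfRot x' y' u' v') : x = x' ∧ y = y' ∧ u = u' ∧ v = v' := by
  simp only [halfRot, Prod.mk.injEq, Zsqrtd.mk.injEq] at h
  omega

lemma fourSq_ncard {n : ℕ} (hn : Odd n) : 8 * n ≤ (fourSq n).ncard := by
  classical
  set I := (antidiagonal (2 * n)).filter fun x => Odd x.1 ∧ Odd x.2 with hI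
  set A : Finset (GaussianInt × GaussianInt) := I.biUnion fun x =>
    (gaussNorm_finite x.1).toFinset ×ˢ (gaussNorm_finite x.2).toFinset with hA
  have hAmem : ∀ q ∈ A, q.1.norm + q.2.norm = 2 * n ∧ q.1.norm % 2 = 1 ∧ q.2.norm % 2 = 1 := by
    intro q hq
    simp only [hA, hI, mem_biUnion, mem_filter, HasAntidiagonal.mem_antidiagonal, mem_product,
      Set.Finite.mem_toFinset, gaussNorm, Set.mem_ofPred_eq] at hq
    obtain ⟨x, ⟨hx, o1, o2⟩, h1, h2⟩ := hq
    rw [Nat.odd_iff] at o1 o2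
    omega
  have hAcard : (16 * n : ℤ) ≤ A.card := by
    rw [hA, card_biUnion]
    · push_cast [card_product]
      have : ∀ x ∈ I, ((gaussNorm_finite x.1).toFinset.card : ℤ)
          * ((gaussNorm_finite x.2).toFinset.card : ℤ) = 16 * (chiSum x.1 * chiSum x.2) := by
        intro x hx
        rw [hI, mem_filter] at hx
        rw [← Set.ncard_eq_toFinset_card _ (gaussNorm_finite x.1),
          ← Set.ncard_eq_toFinset_card _ (gaussNorm_finite x.2),
          gaussNorm_ncard _ hx.2.1, gaussNorm_ncard _ hx.2.2]
        ring
      rw [sum_congr rfl this, ← mul_sum]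
      have := le_sum_chiSum hn
      linarith
    · intro x _ y _ hxy
      refine disjoint_left.2 ?_
      intro q h1 h2
      simp only [mem_product, Set.Finite.mem_toFinset, gaussNorm, Set.mem_ofPred_eq] at h1 h2
      apply hxy
      ext
      · exact_mod_cast h1.1.symm.trans h2.1
      · exact_mod_cast h1.2.symm.trans h2.2
  have hpar : ∀ q ∈ A, q.1.re ^ 2 + q.1.im ^ 2 + (q.2.re ^ 2 + q.2.im ^ 2) = 2 * n ∧
      (q.1.re + q.1.im) % 2 = 1 ∧ (q.2.re + q.2.im) % 2 = 1 := by
    intro q hq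
    obtain ⟨h1, h2, h3⟩ := hAmem q hq
    have key : ∀ z : GaussianInt, z.norm % 2 = 1 → (z.re + z.im) % 2 = 1 := by
      intro z hz
      rw [Zsqrtd.norm_def] at hz
      have e : z.re * z.re - -1 * z.im * z.im
          = (z.re + z.im) + (z.re * (z.re - 1) + z.im * (z.im - 1)) := by ring
      have e1 := Int.even_iff.1 (Int.even_mul_pred_self z.re)
      have e2 := Int.even_iff.1 (Int.even_mul_pred_self z.im)
      omega
    refine ⟨?_, key _ h2, key _ h3⟩
    rw [Zsqrtd.norm_def, Zsqrtd.norm_def] at h1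
    rw [← h1]; ring
  have hsplit := card_filter_add_card_filter_not (s := A) (fun q => q.1.re % 2 = q.2.re % 2)
  have hF : (fourSq n).ncard = (fourSq_finite n).toFinset.card :=
    Set.ncard_eq_toFinset_card _ _
  have hA1 : (A.filter fun q => q.1.re % 2 = q.2.re % 2).card ≤ (fourSq n).ncard := by
    rw [hF]
    refine card_le_card_of_injOn (fun q => halfRot q.1.re q.1.im q.2.re q.2.im) ?_ ?_
    · intro q hq
      rw [mem_coe, mem_filter] at hq
      obtain ⟨h1, h2, h3⟩ := hpar q hq.1
      rw [mem_coe, Set.Finite.mem_toFinset]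
      exact halfRot_mem hq.2 (by omega) h1
    · intro q hq q' hq' h
      rw [mem_coe, mem_filter] at hq hq'
      obtain ⟨h1, h2, h3⟩ := hpar q hq.1
      obtain ⟨h1', h2', h3'⟩ := hpar q' hq'.1
      obtain ⟨e1, e2, e3, e4⟩ :=
        halfRot_inj hq.2 (by omega) hq'.2 (by omega) h
      exact Prod.ext (Zsqrtd.ext e1 e2) (Zsqrtd.ext e3 e4)
  have hA2 : (A.filter fun q => ¬ q.1.re % 2 = q.2.re % 2).card ≤ (fourSq n).ncard := by
    rw [hF]
    refine card_le_card_of_injOn (fun q => halfRot q.1.re q.1.im q.2.im q.2.re) ?_ ?_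
    · intro q hq
      rw [mem_coe, mem_filter] at hq
      obtain ⟨h1, h2, h3⟩ := hpar q hq.1
      rw [mem_coe, Set.Finite.mem_toFinset]
      exact halfRot_mem (by omega) (by omega) (by linarith)
    · intro q hq q' hq' h
      rw [mem_coe, mem_filter] at hq hq'
      obtain ⟨h1, h2, h3⟩ := hpar q hq.1
      obtain ⟨h1', h2', h3'⟩ := hpar q' hq'.1
      obtain ⟨e1, e2, e3, e4⟩ :=
        halfRot_inj (by omega) (by omega) (by omega) (by omega) h
      exact Prod.ext (Zsqrtd.ext e1 e2) (Zsqrtd.ext e4 e3)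
  have : 16 * n ≤ A.card := by exact_mod_cast hAcard
  omega

lemma sph_finite (d lam : ℕ) : (sph d lam).Finite := by
  have hb : Set.Finite (Set.Icc (fun _ => -(lam : ℤ)) (fun _ => (lam : ℤ)) : Set (V d)) :=
    Set.finite_Icc _ _
  have key : ∀ (u : V d), ∑ i, u i ^ 2 ≤ lam →
      u ∈ (Set.Icc (fun _ => -(lam : ℤ)) (fun _ => (lam : ℤ)) : Set (V d)) := by
    intro u hu
    have h : ∀ i, u i ^ 2 ≤ lam := fun i =>
      (single_le_sum (f := fun i => u i ^ 2) (fun j _ => sq_nonneg _) (mem_univ i)).trans hu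
    exact ⟨fun i => by have := h i; simp only; nlinarith, fun i => by
      have := h i; simp only; nlinarith⟩
  refine (hb.prod hb).subset fun uv huv => ?_
  have h1 : 0 ≤ ∑ i, uv.1 i ^ 2 := sum_nonneg fun _ _ => sq_nonneg _
  have h2 : 0 ≤ ∑ i, uv.2 i ^ 2 := sum_nonneg fun _ _ => sq_nonneg _
  simp only [sph, Set.mem_ofPred_eq] at huv
  exact ⟨key _ (by linarith), key _ (by linarith)⟩

/-- Vectors with coordinates in `[0, 2 * L + 1]`, all even except that the first one is
congruent to `ε`. -/
def parityBox (k L : ℕ) (ε : ℤ) : Finset (V (k + 1)) :=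
  Fintype.piFinset fun i => (range (L + 1)).image fun a : ℕ => 2 * (a : ℤ) + if i = 0 then ε else 0

lemma card_parityBox (k L : ℕ) (ε : ℤ) : (parityBox k L ε).card = (L + 1) ^ (k + 1) := by
  rw [parityBox, Fintype.card_piFinset]
  rw [prod_congr rfl (g := fun _ => L + 1), prod_const, card_univ, Fintype.card_fin]
  intro i _
  rw [card_image_of_injective, card_range]
  intro a b h
  simp only at h
  omega

lemma sum_sq_parityBox {k L : ℕ} {ε : ℤ} (h0 : ε = 0 ∨ ε = 1) {u : V (k + 1)}
    (hu : u ∈ parityBox k L ε) :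
    (∑ i, u i ^ 2) % 2 = ε ∧ 0 ≤ ∑ i, u i ^ 2 ∧ ∑ i, u i ^ 2 ≤ (k + 1) * (2 * L + 1) ^ 2 := by
  simp only [parityBox, Fintype.mem_piFinset, mem_image, mem_range] at hu
  refine ⟨?_, sum_nonneg fun _ _ => sq_nonneg _, ?_⟩
  · rw [Fin.sum_univ_succ]
    have he : Even (∑ i : Fin k, u i.succ ^ 2) := by
      refine even_sum _ fun i _ => ?_
      obtain ⟨a, _, ha⟩ := hu i.succ
      rw [← ha]
      simp [Fin.succ_ne_zero, Int.even_pow]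
    obtain ⟨a, _, ha⟩ := hu 0
    rw [Int.even_iff] at he
    simp only [if_true] at ha
    have : u 0 ^ 2 = ε ^ 2 + 2 * (2 * a ^ 2 + 2 * a * ε) := by rw [← ha]; ring
    rcases h0 with rfl | rfl <;> omega
  · have : ∀ i ∈ univ, u i ^ 2 ≤ (2 * (L : ℤ) + 1) ^ 2 := by
      intro i _
      obtain ⟨a, ha, h⟩ := hu i
      have : (a : ℤ) ≤ L := by exact_mod_cast Nat.lt_succ_iff.1 ha
      rw [← h]
      apply pow_le_pow_left₀ <;> split_ifs <;> omega
    have := sum_le_card_nsmul _ _ _ this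
    simpa using this

lemma le_Ncount_of_box {k L lam : ℕ} (h : 4 * ((k + 1) * (2 * L + 1) ^ 2) ≤ lam) :
    (L + 1) ^ (2 * (k + 1)) * (4 * lam) ≤ Ncount (k + 3) lam := by
  classical
  set ε : ℤ := (lam + 1) % 2 with hε
  have hε01 : ε = 0 ∨ ε = 1 := by omega
  set S := (sph_finite (k + 3) lam).toFinset with hS
  have hN : Ncount (k + 3) lam = S.card := by
    rw [Ncount, Nat.card_coe_set_eq, Set.ncard_eq_toFinset_card _ (sph_finite _ _)]
  set g : V (k + 3) × V (k + 3) → V (k + 1) × V (k + 1) :=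
    fun uv => (fun i => uv.1 i.succ.succ, fun i => uv.2 i.succ.succ) with hg
  set B := parityBox k L ε ×ˢ parityBox k L 0 with hB
  have hsum : ∑ y ∈ B, (S.filter fun q => g q = y).card ≤ S.card := by
    rw [sum_card_fiberwise_eq_card_filter]
    exact card_filter_le _ _
  have hfib : ∀ y ∈ B, 4 * lam ≤ (S.filter fun q => g q = y).card := by
    intro y hy
    rw [hB, mem_product] at hy
    obtain ⟨p1, n1, b1⟩ := sum_sq_parityBox hε01 hy.1
    obtain ⟨p2, n2, b2⟩ := sum_sq_parityBox (Or.inl rfl) hy.2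
    set U := ∑ i, y.1 i ^ 2 with hU
    set W := ∑ i, y.2 i ^ 2 with hW
    have hle : 4 * (((k : ℤ) + 1) * (2 * L + 1) ^ 2) ≤ lam := by exact_mod_cast h
    obtain ⟨n, hn⟩ : ∃ n : ℕ, (n : ℤ) = lam - U - W := ⟨(lam - U - W).toNat, by
      rw [Int.toNat_of_nonneg]; linarith⟩
    have hnodd : Odd n := by
      rw [Nat.odd_iff]; omega
    have h2n : 4 * lam ≤ 8 * n := by omega
    refine h2n.trans ((fourSq_ncard hnodd).trans ?_)
    rw [Set.ncard_eq_toFinset_card _ (fourSq_finite n)]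
    refine card_le_card_of_injOn
      (fun q => (Fin.cons q.1.re (Fin.cons q.1.im y.1), Fin.cons q.2.re (Fin.cons q.2.im y.2))) ?_ ?_
    · intro q hq
      rw [mem_coe, Set.Finite.mem_toFinset] at hq
      simp only [fourSq, Set.mem_ofPred_eq, Zsqrtd.norm_def] at hq
      rw [mem_coe, mem_filter, hS, Set.Finite.mem_toFinset]
      refine ⟨?_, ?_⟩
      · simp only [sph, Set.mem_ofPred_eq, Fin.sum_univ_succ (n := k + 2),
          Fin.sum_univ_succ (n := k + 1), Fin.cons_zero, Fin.cons_succ, ← hU, ← hW]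
        linarith
      · simp [hg]
    · intro q _ q' _ hqq
      simp only [Prod.mk.injEq, Fin.cons_inj, and_true] at hqq
      exact Prod.ext (Zsqrtd.ext hqq.1.1 hqq.1.2) (Zsqrtd.ext hqq.2.1 hqq.2.2)
  have := card_nsmul_le_sum B _ _ hfib
  rw [hN]
  refine le_trans (le_of_eq ?_) (this.trans hsum)
  rw [hB, card_product, card_parityBox, card_parityBox, smul_eq_mul]
  ring

/-- The lower bound `N(λ) ≳ λ^{d-1}`. -/
lemma pow_le_mul_Ncount (k lam : ℕ) (hN : 0 < Ncount (k + 3) lam) :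
    (lam.sqrt + 1) ^ (2 * (k + 2)) ≤ (12 * (k + 1)) ^ (2 * (k + 2)) * Ncount (k + 3) lam := by
  set R := lam.sqrt + 1 with hR
  by_cases hs : R ≤ 12 * (k + 1)
  · calc R ^ (2 * (k + 2)) ≤ (12 * (k + 1)) ^ (2 * (k + 2)) := Nat.pow_le_pow_left hs _
      _ ≤ _ := Nat.le_mul_of_pos_right _ hN
  · set L := R / (12 * (k + 1)) with hL
    have hL1 : 1 ≤ L := (Nat.one_le_div_iff (by omega)).2 (by omega)
    have hLR : 12 * (k + 1) * L ≤ R := Nat.mul_div_le _ _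
    have hRL : R ≤ 12 * (k + 1) * (L + 1) := (Nat.lt_mul_div_succ R (by omega)).le
    have hlam : lam.sqrt * lam.sqrt ≤ lam := Nat.sqrt_le lam
    have hlam4 : R * R ≤ 4 * lam := by nlinarith
    have hbox : 4 * ((k + 1) * (2 * L + 1) ^ 2) ≤ lam := by
      have e1 : 4 * ((k + 1) * (2 * L + 1)) ≤ R := by nlinarith
      have e2 : (4 * ((k + 1) * (2 * L + 1))) * (4 * ((k + 1) * (2 * L + 1))) ≤ R * R :=
        Nat.mul_le_mul e1 e1
      have e3 : 16 * ((k + 1) * (2 * L + 1) ^ 2)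
          ≤ (4 * ((k + 1) * (2 * L + 1))) * (4 * ((k + 1) * (2 * L + 1))) := by
        have : (k + 1) ≤ (k + 1) * (k + 1) := Nat.le_mul_of_pos_right _ (by omega)
        calc 16 * ((k + 1) * (2 * L + 1) ^ 2) ≤ 16 * ((k + 1) * (k + 1) * (2 * L + 1) ^ 2) := by
              gcongr
          _ = _ := by ring
      omega
    have hmain := le_Ncount_of_box hbox
    calc R ^ (2 * (k + 2)) = R ^ (2 * (k + 1)) * (R * R) := by ring
      _ ≤ (12 * (k + 1) * (L + 1)) ^ (2 * (k + 1)) * (4 * lam) := by gcongr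
      _ = (12 * (k + 1)) ^ (2 * (k + 1)) * ((L + 1) ^ (2 * (k + 1)) * (4 * lam)) := by
          rw [mul_pow]; ring
      _ ≤ (12 * (k + 1)) ^ (2 * (k + 2)) * Ncount (k + 3) lam := by
          gcongr <;> omega

lemma card_le_of_modEq {H q : ℕ} (A : Finset ℕ) (hA : A ⊆ Icc 1 H)
    (h : ∀ m ∈ A, ∀ n ∈ A, m ≡ n [MOD q]) : A.card ≤ H / q + 1 := by
  rw [← card_range (H / q + 1)]
  refine card_le_card_of_injOn (fun n => n / q) ?_ ?_
  · intro n hn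
    have := mem_Icc.1 (hA hn)
    rw [mem_coe, mem_range, Nat.lt_succ_iff]
    exact Nat.div_le_div_right this.2
  · intro m hm n hn hmn
    have h1 : m % q = n % q := h m hm n hn
    simp only at hmn
    rw [← Nat.div_add_mod m q, ← Nat.div_add_mod n q, hmn, h1]

lemma sum_inv_Icc_le (q : ℕ) : ∑ r ∈ Icc 1 (q - 1), (1 / (r : ℝ) + 1 / ((q : ℝ) - r))
    ≤ 2 * (1 + Real.log q) := by
  have hh : ∑ r ∈ Icc 1 (q - 1), 1 / (r : ℝ) ≤ 1 + Real.log q := by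
    have h1 := harmonic_le_one_add_log (q - 1)
    rw [harmonic_eq_sum_Icc] at h1
    push_cast at h1
    simp only [one_div]
    refine h1.trans (add_le_add_right ?_ _)
    rcases Nat.eq_zero_or_pos (q - 1) with h | h
    · rw [h]
      simp only [Nat.cast_zero, Real.log_zero]
      exact Real.log_natCast_nonneg q
    · refine Real.log_le_log (by exact_mod_cast h) ?_
      exact_mod_cast Nat.sub_le _ _
  have hr : ∑ r ∈ Icc 1 (q - 1), 1 / ((q : ℝ) - r) = ∑ r ∈ Icc 1 (q - 1), 1 / (r : ℝ) := by
    refine sum_nbij' (fun r => q - r) (fun r => q - r) ?_ ?_ ?_ ?_ ?_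
    · intro r hr; rw [mem_Icc] at hr ⊢; omega
    · intro r hr; rw [mem_Icc] at hr ⊢; omega
    · intro r hr; rw [mem_Icc] at hr; omega
    · intro r hr; rw [mem_Icc] at hr; omega
    · intro r hr; rw [mem_Icc] at hr; rw [Nat.cast_sub (by omega)]
  rw [sum_add_distrib, hr]
  linarith

lemma sum_not_dvd_le {H q : ℕ} (hq : 0 < q) {a : ℤ} (hco : IsCoprime a (q : ℤ)) {φ : ℝ}
    (hφ : |φ - a / q| ≤ 1 / ((2 * H + 1) * q)) (T : ℕ → ℝ)
    (hT : ∀ n ∈ Icc 1 H, ∀ δ : ℝ, 0 ≤ δ → (∀ z : ℤ, δ ≤ |n * φ - z|) → T n * δ ≤ 1) :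
    ∑ n ∈ Icc 1 H with ¬ q ∣ n, T n ≤ 4 * (H + q) * (1 + Real.log q) := by
  have hqR : (0 : ℝ) < q := by exact_mod_cast hq
  have hqZ : (0 : ℤ) < q := by exact_mod_cast hq
  set ρ : ℕ → ℕ := fun n => ((n * a) % q : ℤ).toNat with hρ
  have hρc : ∀ n, (ρ n : ℤ) = (n * a) % q := fun n =>
    Int.toNat_of_nonneg (Int.emod_nonneg _ hqZ.ne')
  have hmaps : ∀ n ∈ (Icc 1 H).filter (fun n => ¬ q ∣ n), ρ n ∈ Icc 1 (q - 1) := by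
    intro n hn
    rw [mem_filter] at hn
    have h1 := hρc n
    have h2 := Int.emod_lt_of_pos (n * a) hqZ
    have h3 : (n * a : ℤ) % q ≠ 0 := by
      intro h
      have h4 : (q : ℤ) ∣ n * a := Int.dvd_of_emod_eq_zero h
      have h5 : (q : ℤ) ∣ n := hco.symm.dvd_of_dvd_mul_right h4
      exact hn.2 (by exact_mod_cast h5)
    rw [mem_Icc]
    omega
  have hterm : ∀ n ∈ (Icc 1 H).filter (fun n => ¬ q ∣ n),
      T n ≤ 2 * q * (1 / (ρ n : ℝ) + 1 / ((q : ℝ) - ρ n)) := by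
    intro n hn
    have hm := hmaps n hn
    rw [mem_filter] at hn
    rw [mem_Icc] at hm
    have hnH := (mem_Icc.1 hn.1).2
    set r : ℝ := (ρ n : ℝ) with hr
    have hr1 : 1 ≤ r := by rw [hr]; exact_mod_cast hm.1
    have hr2 : r + 1 ≤ q := by
      rw [hr]
      exact_mod_cast (by omega : ρ n + 1 ≤ q)
    set μ := min r (q - r) with hμ
    have hμ1 : 1 ≤ μ := le_min hr1 (by linarith)
    obtain ⟨k, hk⟩ : ∃ k : ℤ, (n : ℝ) * a = q * k + r := by
      refine ⟨(n * a) / q, ?_⟩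
      rw [hr]
      have := Int.mul_ediv_add_emod (n * a) q
      rw [← hρc] at this
      exact_mod_cast this.symm
    have hδ : ∀ z : ℤ, μ / (2 * q) ≤ |n * φ - z| := by
      intro z
      have hsplit : (n : ℝ) * φ - z = n * (φ - a / q) + (q * (k - z) + r) / q := by
        rw [mul_sub, mul_div_assoc', hk]; field_simp; ring
      have h1 : |(n : ℝ) * (φ - a / q)| ≤ 1 / (2 * q) := by
        rw [abs_mul, Nat.abs_cast]
        have hnR : (n : ℝ) ≤ H := by exact_mod_cast hnH
        calc (n : ℝ) * |φ - a / q| ≤ H * (1 / ((2 * H + 1) * q)) := by gcongr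
          _ ≤ 1 / (2 * q) := by
            rw [mul_one_div, div_le_div_iff₀ (by positivity) (by positivity)]
            nlinarith
      have h2 : μ / q ≤ |(q * ((k : ℝ) - z) + r) / q| := by
        rw [abs_div, abs_of_pos hqR]
        gcongr
        rcases le_or_gt 0 (k - z) with h | h
        · have h' : (0 : ℝ) ≤ (k : ℝ) - z := by exact_mod_cast h
          refine (min_le_left _ _).trans (le_trans ?_ (le_abs_self _))
          nlinarith
        · have h' : (k : ℝ) - z ≤ -1 := by
            have : k - z ≤ -1 := by omega
            exact_mod_cast this
          refine (min_le_right _ _).trans (le_trans ?_ (neg_le_abs _))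
          nlinarith
      have h3 := abs_sub_abs_le_abs_add ((q * ((k : ℝ) - z) + r) / q) ((n : ℝ) * (φ - a / q))
      rw [hsplit, add_comm]
      have h4 : 1 / (2 * q) ≤ μ / (2 * q) := by gcongr
      have h5 : μ / q = μ / (2 * q) + μ / (2 * q) := by field_simp; norm_num
      linarith
    have h6 := hT n hn.1 (μ / (2 * q)) (by positivity) hδ
    have h7 : T n ≤ 2 * q * (1 / μ) := by
      rw [mul_div_assoc', div_le_iff₀ (by positivity)] at h6
      rw [mul_one_div, le_div_iff₀ (by positivity)]
      linarith
    refine h7.trans ?_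
    gcongr
    have hp1 : 0 < 1 / r := by positivity
    have hp2 : 0 < 1 / ((q : ℝ) - r) := one_div_pos.2 (by linarith)
    rcases min_cases r (q - r) with ⟨h, _⟩ | ⟨h, _⟩
    · rw [hμ, h]; linarith
    · rw [hμ, h]; linarith
  have hcard : ∀ r ∈ Icc 1 (q - 1),
      ∑ n ∈ ((Icc 1 H).filter (fun n => ¬ q ∣ n)) with ρ n = r, T n
        ≤ ((H : ℝ) / q + 1) * (2 * q * (1 / (r : ℝ) + 1 / ((q : ℝ) - r))) := by
    intro r hr
    rw [mem_Icc] at hr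
    set A := ((Icc 1 H).filter (fun n => ¬ q ∣ n)).filter (fun n => ρ n = r) with hA
    have hAc : A.card ≤ H / q + 1 := by
      apply card_le_of_modEq A ((filter_subset _ _).trans (filter_subset _ _))
      intro m hm n hn
      rw [hA, mem_filter] at hm hn
      have e : (m * a) ≡ (n * a) [ZMOD q] := by
        unfold Int.ModEq
        rw [← hρc, ← hρc, hm.2, hn.2]
      have e1 : (q : ℤ) ∣ (n - m) * a := by
        rw [sub_mul]; exact e.dvd
      have e2 : (q : ℤ) ∣ n - m := hco.symm.dvd_of_dvd_mul_right e1
      exact (Nat.modEq_iff_dvd).2 e2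
    have hcR : (A.card : ℝ) ≤ (H : ℝ) / q + 1 := by
      refine (Nat.cast_le.2 hAc).trans ?_
      push_cast
      gcongr
      exact Nat.cast_div_le
    have hrq : (r : ℝ) + 1 ≤ q := by exact_mod_cast (by omega : r + 1 ≤ q)
    have hnn : 0 ≤ 2 * q * (1 / (r : ℝ) + 1 / ((q : ℝ) - r)) := by
      have : 0 ≤ 1 / ((q : ℝ) - r) := one_div_nonneg.2 (by linarith)
      positivity
    refine le_trans (sum_le_card_nsmul A T (2 * q * (1 / (r : ℝ) + 1 / ((q : ℝ) - r)))
      fun n hn => ?_) ?_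
    · rw [hA, mem_filter] at hn
      have := hterm n hn.1
      rwa [hn.2] at this
    · rw [nsmul_eq_mul]
      gcongr
  rw [← sum_fiberwise_of_maps_to hmaps]
  refine (sum_le_sum hcard).trans ?_
  rw [← mul_sum, ← mul_sum]
  calc ((H : ℝ) / q + 1) * (2 * q * ∑ r ∈ Icc 1 (q - 1), (1 / (r : ℝ) + 1 / ((q : ℝ) - r)))
      ≤ ((H : ℝ) / q + 1) * (2 * q * (2 * (1 + Real.log q))) := by
        gcongr; exact sum_inv_Icc_le q
    _ = 4 * (H + q) * (1 + Real.log q) := by field_simp; ring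

lemma sum_inv_sqrt_le (K : ℕ) : ∑ k ∈ Icc 1 K, 1 / √(k : ℝ) ≤ 2 * √(K : ℝ) := by
  induction K with
  | zero => simp
  | succ K ih =>
    rw [← Finset.insert_Icc_right_eq_Icc_add_one (by omega), sum_insert (by simp)]
    have h1 : 0 < √((K + 1 : ℕ) : ℝ) := Real.sqrt_pos.2 (by positivity)
    have h2 : √(K : ℝ) ≤ √((K + 1 : ℕ) : ℝ) := Real.sqrt_le_sqrt (by push_cast; linarith)
    have h3 := Real.mul_self_sqrt (Nat.cast_nonneg (α := ℝ) K)
    have h4 := Real.mul_self_sqrt (Nat.cast_nonneg (α := ℝ) (K + 1))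
    have h5 := Real.sqrt_nonneg (K : ℝ)
    push_cast at h4 h1 h2 ⊢
    have : 1 / √((K : ℝ) + 1) ≤ 2 * √((K : ℝ) + 1) - 2 * √(K : ℝ) := by
      rw [div_le_iff₀ h1]
      nlinarith
    linarith

lemma sum_dvd_le {R q : ℕ} (hR : 0 < R) (hq : 0 < q) {a : ℤ} {φ : ℝ}
    (hφ : |φ - a / q| ≤ 1 / ((2 * (2 * R : ℕ) + 1) * q)) (T : ℕ → ℝ)
    (hT0 : ∀ n, 0 ≤ T n) (hTR : ∀ n, T n ≤ 6 * R)
    (hT : ∀ n ∈ Icc 1 (2 * R), ∀ δ : ℝ, 0 ≤ δ → (∀ z : ℤ, δ ≤ |n * φ - z|) → T n * δ ≤ 1) :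
    ∑ n ∈ Icc 1 (2 * R) with q ∣ n, T n
      ≤ 36 * (R ^ 2 / q) / √(1 + R ^ 2 * |φ - a / q|) := by
  have hqR : (0 : ℝ) < q := by exact_mod_cast hq
  have hRR : (0 : ℝ) < R := by exact_mod_cast hR
  set β := φ - a / q with hβ
  set x := (R : ℝ) ^ 2 * |β| with hx
  have hx0 : 0 ≤ x := by positivity
  have hterm : ∀ k ∈ Icc 1 (2 * R / q), T (q * k)
      ≤ 9 * (R * √(R / q)) / √(1 + x) * (1 / √(k : ℝ)) := by
    intro k hk
    rw [mem_Icc] at hk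
    have hk1 : (1 : ℝ) ≤ k := by exact_mod_cast hk.1
    have hkq : q * k ≤ 2 * R := by
      rw [mul_comm]; exact (Nat.le_div_iff_mul_le hq).1 hk.2
    have hkqR : (q : ℝ) * k ≤ 2 * R := by exact_mod_cast hkq
    have hmem : q * k ∈ Icc 1 (2 * R) := mem_Icc.2 ⟨Nat.mul_pos hq hk.1, hkq⟩
    have hsmall : q * k * |β| ≤ 1 / 2 := by
      calc (q : ℝ) * k * |β| ≤ (2 * R) * (1 / ((2 * (2 * R : ℕ) + 1) * q)) := by gcongr
        _ ≤ 1 / 2 := by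
          have : (1 : ℝ) ≤ q := by exact_mod_cast hq
          rw [mul_one_div, div_le_div_iff₀ (by positivity) (by positivity)]
          push_cast
          nlinarith
    have h1 := hT (q * k) hmem (q * k * |β|) (by positivity) (by
      intro z
      have e : ((q * k : ℕ) : ℝ) * φ - z = q * k * β + ((k * a - z : ℤ) : ℝ) := by
        rw [hβ]; push_cast; field_simp; ring
      have e1 : |(q : ℝ) * k * β| = q * k * |β| := by
        rw [abs_mul, abs_of_nonneg (by positivity)]
      rw [e]
      by_cases hz : (k * a - z : ℤ) = 0
      · rw [hz, Int.cast_zero, add_zero, e1]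
      · have h2 : (1 : ℝ) ≤ |((k * a - z : ℤ) : ℝ)| := by
          rw [← Int.cast_abs]; exact_mod_cast Int.one_le_abs hz
        have h3 := abs_sub_abs_le_abs_add ((k * a - z : ℤ) : ℝ) ((q : ℝ) * k * β)
        rw [add_comm (((k * a - z : ℤ) : ℝ)), e1] at h3
        linarith)
    set t := T (q * k) with ht
    have ht0 : 0 ≤ t := hT0 _
    have htR : t ≤ 6 * R := hTR _
    have hm : 0 < (q : ℝ) * k := by positivity
    have h4 : t ^ 2 * (1 + x) ≤ 81 * (R ^ 3 / (q * k)) := by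
      rw [mul_div_assoc', le_div_iff₀ hm]
      have a1 : t ^ 2 * (q * k) ≤ 36 * R ^ 2 * (2 * R) := by
        have : t ^ 2 ≤ (6 * R) ^ 2 := pow_le_pow_left₀ ht0 htR 2
        have : t ^ 2 ≤ 36 * R ^ 2 := by linarith
        gcongr
      have a2 : t ^ 2 * x * (q * k) ≤ 6 * R * R ^ 2 := by
        have : t ^ 2 * x * (q * k) = (t * (q * k * |β|)) * (t * R ^ 2) := by rw [hx]; ring
        rw [this]
        calc (t * (q * k * |β|)) * (t * (R : ℝ) ^ 2) ≤ 1 * (t * (R : ℝ) ^ 2) := by gcongr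
          _ ≤ 6 * (R : ℝ) * (R : ℝ) ^ 2 := by rw [one_mul]; gcongr
      have : (0 : ℝ) < R ^ 3 := by positivity
      nlinarith
    have h5 : t ≤ √(81 * (R ^ 3 / (q * k)) / (1 + x)) := by
      apply Real.le_sqrt_of_sq_le
      rwa [le_div_iff₀ (by positivity)]
    refine h5.trans (le_of_eq ?_)
    have e : 81 * ((R : ℝ) ^ 3 / (q * k)) / (1 + x) = (9 * R) ^ 2 * (R / q) / (1 + x) * (1 / k) := by
      field_simp; ring
    rw [e, Real.sqrt_mul (by positivity), Real.sqrt_div (by positivity),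
      Real.sqrt_mul (by positivity), Real.sqrt_sq (by positivity), Real.sqrt_div zero_le_one,
      Real.sqrt_one]
    ring
  have hre : ∑ n ∈ Icc 1 (2 * R) with q ∣ n, T n = ∑ k ∈ Icc 1 (2 * R / q), T (q * k) := by
    symm
    refine sum_nbij (fun k => q * k) ?_ ?_ ?_ ?_
    · intro k hk
      rw [mem_Icc] at hk
      rw [mem_filter, mem_Icc]
      refine ⟨⟨Nat.mul_pos hq hk.1, ?_⟩, dvd_mul_right _ _⟩
      rw [mul_comm]; exact (Nat.le_div_iff_mul_le hq).1 hk.2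
    · exact fun x _ y _ h => Nat.eq_of_mul_eq_mul_left hq h
    · intro n hn
      rw [mem_coe, mem_filter, mem_Icc] at hn
      obtain ⟨⟨h1, h2⟩, k, rfl⟩ := hn
      refine ⟨k, ?_, rfl⟩
      rw [mem_coe, mem_Icc]
      exact ⟨Nat.pos_of_mul_pos_left h1, (Nat.le_div_iff_mul_le hq).2 (by rwa [mul_comm])⟩
    · intro _ _; rfl
  rw [hre]
  refine (sum_le_sum hterm).trans ?_
  rw [← mul_sum]
  have hK : √((2 * R / q : ℕ) : ℝ) ≤ 2 * √(R / q) := by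
    rw [Real.sqrt_le_left (by positivity), mul_pow, Real.sq_sqrt (by positivity)]
    have : ((2 * R / q : ℕ) : ℝ) ≤ ((2 * R : ℕ) : ℝ) / q := Nat.cast_div_le
    push_cast at this
    have h0 : 0 ≤ (R : ℝ) / q := by positivity
    have h1 : 2 * (R : ℝ) / q = 2 * (R / q) := by ring
    linarith
  calc 9 * (R * √(R / q)) / √(1 + x) * ∑ k ∈ Icc 1 (2 * R / q), 1 / √(k : ℝ)
      ≤ 9 * (R * √(R / q)) / √(1 + x) * (2 * (2 * √(R / q))) := by
        gcongr
        exact (sum_inv_sqrt_le _).trans (by gcongr)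
    _ = 36 * (R * (√(R / q) * √(R / q))) / √(1 + x) := by ring
    _ = 36 * (R ^ 2 / q) / √(1 + x) := by
        rw [Real.mul_self_sqrt (by positivity)]; ring

lemma exists_rational_approx_sum_le {R : ℕ} (hR : 0 < R) (φ : ℝ) (T : ℕ → ℝ)
    (hT0 : ∀ n, 0 ≤ T n) (hTR : ∀ n, T n ≤ 6 * R)
    (hT : ∀ n ∈ Icc 1 (2 * R), ∀ δ : ℝ, 0 ≤ δ → (∀ z : ℤ, δ ≤ |n * φ - z|) → T n * δ ≤ 1) :
    ∃ (q : ℕ) (a : ℤ), 0 < q ∧ q ≤ 4 * R ∧ |φ - a / q| ≤ 1 / q ∧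
      ∑ n ∈ Icc 1 (2 * R), T n
        ≤ 36 * (R ^ 2 / q) / √(1 + R ^ 2 * |φ - a / q|) + 24 * R * (1 + Real.log (4 * R)) := by
  have hRR : (1 : ℝ) ≤ R := by exact_mod_cast hR
  obtain ⟨s, hs1, hs2⟩ := Real.exists_rat_abs_sub_le_and_den_le φ (n := 2 * (2 * R)) (by omega)
  have hq : 0 < s.den := s.pos
  have hs : (s : ℝ) = (s.num : ℝ) / (s.den : ℝ) := by exact_mod_cast (Rat.num_div_den s).symm
  rw [hs] at hs1
  have hco : IsCoprime s.num (s.den : ℤ) := by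
    rw [Int.isCoprime_iff_gcd_eq_one]
    exact s.reduced
  have hφ : |φ - s.num / s.den| ≤ 1 / ((2 * (2 * R : ℕ) + 1) * s.den) := by
    refine hs1.trans (le_of_eq ?_)
    push_cast; ring
  have hq1 : (1 : ℝ) ≤ s.den := by exact_mod_cast hq
  refine ⟨s.den, s.num, hq, by omega, hφ.trans ?_, ?_⟩
  · gcongr
    have : (0 : ℝ) ≤ ((2 * R : ℕ) : ℝ) := by positivity
    nlinarith
  rw [← sum_filter_add_sum_filter_not (Icc 1 (2 * R)) (fun n => s.den ∣ n)]
  refine add_le_add (sum_dvd_le hR hq hφ T hT0 hTR hT) ?_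
  refine (sum_not_dvd_le hq hco hφ T hT).trans ?_
  have hs2' : (s.den : ℝ) ≤ 4 * R := by
    have : (s.den : ℝ) ≤ ((2 * (2 * R) : ℕ) : ℝ) := by exact_mod_cast hs2
    push_cast at this; linarith
  have hlog := Real.log_le_log (by positivity) hs2'
  have hlog0 := Real.log_nonneg hq1
  push_cast
  have : 4 * (2 * (R : ℝ) + s.den) ≤ 24 * R := by linarith
  gcongr

lemma sum_Icc_neg_eq {E : Type*} [AddCommGroup E] (H : ℕ) (f : ℤ → E) :
    ∑ h ∈ Icc (-(H : ℤ)) H, f h = f 0 + ∑ n ∈ Icc 1 H, (f n + f (-(n : ℤ))) := by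
  induction H with
  | zero => simp
  | succ H ih =>
    have e : Icc (-((H + 1 : ℕ) : ℤ)) ((H + 1 : ℕ) : ℤ)
        = insert ((H + 1 : ℕ) : ℤ) (insert (-((H + 1 : ℕ) : ℤ)) (Icc (-(H : ℤ)) H)) := by
      ext x
      simp only [mem_Icc, mem_insert]
      push_cast
      omega
    rw [e, sum_insert (by simp only [mem_insert, mem_Icc]; push_cast; omega),
      sum_insert (by simp only [mem_Icc]; push_cast; omega), ih,
      ← Finset.insert_Icc_right_eq_Icc_add_one (by omega), sum_insert (by simp)]
    abel

lemma sum_Icc_zpow (w : ℂ) (hw : w ≠ 0) (a b : ℤ) :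
    ∑ v ∈ Icc a b, w ^ v = w ^ a * ∑ k ∈ range (b + 1 - a).toNat, w ^ k := by
  rw [mul_sum]
  symm
  refine sum_nbij' (fun k : ℕ => a + (k : ℤ)) (fun v => (v - a).toNat) ?_ ?_ ?_ ?_ ?_
  · intro k hk; rw [mem_range] at hk; rw [mem_Icc]; omega
  · intro v hv; rw [mem_Icc] at hv; rw [mem_range]; omega
  · intro k hk; simp
  · intro v hv; rw [mem_Icc] at hv; omega
  · intro k _; rw [zpow_add₀ hw, zpow_natCast]

lemma two_mul_le_abs_sin {α δ : ℝ} (hδ : ∀ z : ℤ, δ ≤ |α - z|) :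
    2 * δ ≤ |Real.sin (Real.pi * α)| := by
  set z := round α with hz
  have h1 : |α - z| ≤ 1 / 2 := abs_sub_round α
  have h2 : |Real.sin (Real.pi * α)| = Real.sin (Real.pi * |α - z|) := by
    have e : Real.pi * α = Real.pi * (α - z) + z * Real.pi := by ring
    rw [e, Real.sin_add_int_mul_pi, abs_mul, abs_zpow, abs_neg, abs_one, one_zpow, one_mul,
      Real.abs_sin_eq_sin_abs_of_abs_le_pi, abs_mul, abs_of_pos Real.pi_pos]
    · rw [abs_mul, abs_of_pos Real.pi_pos]
      nlinarith [Real.pi_pos]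
  rw [h2]
  have h3 := Real.mul_le_sin (x := Real.pi * |α - z|) (by positivity)
    (by nlinarith [Real.pi_pos])
  have h4 : 2 / Real.pi * (Real.pi * |α - z|) = 2 * |α - z| := by
    field_simp
  have := hδ z
  linarith

lemma norm_sum_zpow_mul_le {α δ : ℝ} (hδ0 : 0 ≤ δ) (hδ : ∀ z : ℤ, δ ≤ |α - z|) (a b : ℤ) :
    ‖∑ v ∈ Icc a b, Complex.exp (Complex.I * (2 * Real.pi * α : ℝ)) ^ v‖ * δ ≤ 1 / 2 := by
  rcases hδ0.eq_or_lt with rfl | hpos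
  · simp
  set w := Complex.exp (Complex.I * (2 * Real.pi * α : ℝ)) with hw
  have hw1 : ‖w‖ = 1 := by rw [hw, mul_comm]; exact Complex.norm_exp_ofReal_mul_I _
  have hwn : 4 * δ ≤ ‖w - 1‖ := by
    rw [hw, Complex.norm_exp_I_mul_ofReal_sub_one, Real.norm_eq_abs, abs_mul]
    have e : 2 * Real.pi * α / 2 = Real.pi * α := by ring
    rw [e, abs_two]
    have := two_mul_le_abs_sin hδ
    linarith
  have hne : w ≠ 1 := by
    intro h; rw [h, sub_self, norm_zero] at hwn; linarith
  rw [sum_Icc_zpow w (Complex.exp_ne_zero _), norm_mul, norm_zpow, hw1, one_zpow, one_mul,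
    geom_sum_eq hne, norm_div]
  have hnum : ‖w ^ (b + 1 - a).toNat - 1‖ ≤ 2 := by
    refine (norm_sub_le _ _).trans ?_
    rw [norm_pow, hw1, one_pow, norm_one]; norm_num
  have h0 : 0 < ‖w - 1‖ := by linarith
  rw [div_mul_eq_mul_div, div_le_iff₀ h0]
  nlinarith

/-- The quadratic exponential sum `∑_{|u| ≤ R} e(j u² / M)`. -/
def gaussSum (M R : ℕ) [NeZero M] (j : ZMod M) : ℂ :=
  ∑ u ∈ Icc (-(R : ℤ)) R, ZMod.stdAddChar (j * ((u ^ 2 : ℤ) : ZMod M))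

/-- The linear exponential sum arising from differencing `gaussSum` with step `h`. -/
def diffSum (M R : ℕ) [NeZero M] (j : ZMod M) (h : ℤ) : ℂ :=
  ∑ v ∈ Icc (max (-(R : ℤ)) (-R - h)) (min (R : ℤ) (R - h)),
    ZMod.stdAddChar (j * ((2 * h * v : ℤ) : ZMod M))

variable {M : ℕ} [NeZero M]

lemma norm_stdAddChar (x : ZMod M) : ‖(ZMod.stdAddChar x : ℂ)‖ = 1 :=
  AddChar.norm_apply _ _

lemma norm_gaussSum_le (R : ℕ) (j : ZMod M) : ‖gaussSum M R j‖ ≤ 2 * R + 1 := by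
  refine (norm_sum_le _ _).trans ?_
  simp only [norm_stdAddChar, sum_const, nsmul_eq_mul, mul_one, Int.card_Icc]
  have : ((R : ℤ) + 1 - -(R : ℤ)).toNat = 2 * R + 1 := by omega
  rw [this]; push_cast; rfl

lemma norm_diffSum_le (R : ℕ) (j : ZMod M) (h : ℤ) : ‖diffSum M R j h‖ ≤ 2 * R + 1 := by
  refine (norm_sum_le _ _).trans ?_
  simp only [norm_stdAddChar, sum_const, nsmul_eq_mul, mul_one, Int.card_Icc]
  have : (min (R : ℤ) (R - h) + 1 - max (-(R : ℤ)) (-R - h)).toNat ≤ 2 * R + 1 := by omega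
  exact_mod_cast this

lemma norm_gaussSum_sq_le (R : ℕ) (j : ZMod M) :
    ‖gaussSum M R j‖ ^ 2 ≤ ∑ h ∈ Icc (-((2 * R : ℕ) : ℤ)) ((2 * R : ℕ) : ℤ), ‖diffSum M R j h‖ := by
  have h1 : gaussSum M R j * (starRingEnd ℂ) (gaussSum M R j)
      = ∑ h ∈ Icc (-((2 * R : ℕ) : ℤ)) ((2 * R : ℕ) : ℤ),
        ZMod.stdAddChar (j * ((h ^ 2 : ℤ) : ZMod M)) * diffSum M R j h := by
    unfold gaussSum
    rw [map_sum, sum_mul_sum, ← sum_product',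
      ← sum_fiberwise_of_maps_to (g := fun p : ℤ × ℤ => p.1 - p.2)
        (t := Icc (-((2 * R : ℕ) : ℤ)) ((2 * R : ℕ) : ℤ))]
    · refine sum_congr rfl fun h _ => ?_
      unfold diffSum
      rw [mul_sum]
      refine sum_nbij' (fun p => p.2) (fun v => (v + h, v)) ?_ ?_ ?_ ?_ ?_
      · rintro ⟨u, v⟩ hp
        simp only [mem_filter, mem_product, mem_Icc] at hp ⊢
        omega
      · intro v hv
        simp only [mem_filter, mem_product, mem_Icc] at hv ⊢
        omega
      · rintro ⟨u, v⟩ hp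
        simp only [mem_filter] at hp
        simp only [Prod.mk.injEq, and_true]
        omega
      · intro v _; rfl
      · rintro ⟨u, v⟩ hp
        simp only [mem_filter] at hp
        obtain ⟨_, rfl⟩ := hp
        simp only
        rw [← AddChar.map_neg_eq_conj, ← AddChar.map_add_eq_mul, ← AddChar.map_add_eq_mul]
        congr 1
        push_cast; ring
    · rintro ⟨u, v⟩ hp
      simp only [mem_product, mem_Icc] at hp ⊢
      push_cast
      omega
  have h2 : ‖gaussSum M R j‖ ^ 2 = ‖gaussSum M R j * (starRingEnd ℂ) (gaussSum M R j)‖ := by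
    rw [norm_mul, RCLike.norm_conj, sq]
  rw [h2, h1]
  refine (norm_sum_le _ _).trans (sum_le_sum fun h _ => ?_)
  rw [norm_mul, norm_stdAddChar, one_mul]

lemma norm_diffSum_mul_le (R : ℕ) (j : ZMod M) (h : ℤ) {δ : ℝ} (hδ0 : 0 ≤ δ)
    (hδ : ∀ z : ℤ, δ ≤ |h * (2 * j.val / M : ℝ) - z|) : ‖diffSum M R j h‖ * δ ≤ 1 / 2 := by
  have key := norm_sum_zpow_mul_le hδ0 hδ (max (-(R : ℤ)) (-R - h)) (min (R : ℤ) (R - h))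
  have e : diffSum M R j h = ∑ v ∈ Icc (max (-(R : ℤ)) (-R - h)) (min (R : ℤ) (R - h)),
      Complex.exp (Complex.I * (2 * Real.pi * (h * (2 * j.val / M)) : ℝ)) ^ v := by
    refine sum_congr rfl fun v _ => ?_
    have e1 : j * ((2 * h * v : ℤ) : ZMod M) = ((j.val * (2 * h * v) : ℤ) : ZMod M) := by
      push_cast
      rw [ZMod.natCast_zmod_val]
    rw [e1, ZMod.stdAddChar_coe, ← Complex.exp_int_mul]
    congr 1
    push_cast
    ring
  rw [e]
  exact key

/-- Weyl's inequality in the form of a major arc approximation. -/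
lemma norm_gaussSum_sq_le_rational {R : ℕ} (hR : 0 < R) (j : ZMod M) :
    ∃ (q : ℕ) (a : ℤ), 0 < q ∧ q ≤ 4 * R ∧ |(2 * j.val / M : ℝ) - a / q| ≤ 1 / q ∧
      ‖gaussSum M R j‖ ^ 2
        ≤ 36 * (R ^ 2 / q) / √(1 + R ^ 2 * |(2 * j.val / M : ℝ) - a / q|)
          + 27 * R * (1 + Real.log (4 * R)) := by
  have hRR : (1 : ℝ) ≤ R := by exact_mod_cast hR
  obtain ⟨q, a, hq, hq4, hβ, hsum⟩ := exists_rational_approx_sum_le hR (2 * j.val / M : ℝ)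
    (fun n => ‖diffSum M R j n‖ + ‖diffSum M R j (-(n : ℤ))‖) (fun n => by positivity)
    (fun n => by
      have h1 := norm_diffSum_le R j n
      have h2 := norm_diffSum_le R j (-(n : ℤ))
      linarith)
    (fun n _ δ hδ0 hδ => by
      have h1 := norm_diffSum_mul_le R j n hδ0 (by exact_mod_cast hδ)
      have h2 := norm_diffSum_mul_le R j (-(n : ℤ)) hδ0 (fun z => by
        refine (hδ (-z)).trans (le_of_eq ?_)
        rw [← abs_neg]
        congr 1
        push_cast; ring)
      rw [add_mul]
      linarith)
  refine ⟨q, a, hq, hq4, hβ, ?_⟩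
  refine (norm_gaussSum_sq_le R j).trans ?_
  rw [sum_Icc_neg_eq (2 * R) (fun h => ‖diffSum M R j h‖)]
  have h0 := norm_diffSum_le R j 0
  have hlog : 0 ≤ Real.log (4 * R) := Real.log_nonneg (by linarith)
  nlinarith

lemma summable_one_add_abs_int {b : ℝ} (hb : 1 < b) :
    Summable fun n : ℤ => (1 + |(n : ℝ)|) ^ (-b) := by
  have h : Summable fun n : ℕ => (1 + |((n : ℤ) : ℝ)|) ^ (-b) := by
    refine ((Real.summable_one_div_nat_add_rpow 1 b).2 hb).congr fun n => ?_
    have : (0 : ℝ) ≤ (n : ℝ) + 1 := by positivity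
    rw [Int.cast_natCast, Nat.abs_cast, abs_of_nonneg this, Real.rpow_neg (by positivity), one_div,
      add_comm]
  refine Summable.of_nat_of_neg h (h.congr fun n => ?_)
  push_cast
  rw [abs_neg]

lemma sum_one_add_abs_le {b : ℝ} (hb : 1 < b) (c : ℝ) :
    ∑ j : ZMod M, (1 + |2 * (j.val : ℝ) - c|) ^ (-b) ≤ ∑' n : ℤ, (1 + |(n : ℝ)|) ^ (-b) := by
  set z := round (c / 2) with hz
  have hz2 : |c / 2 - z| ≤ 1 / 2 := abs_sub_round _
  have hinj : Function.Injective fun j : ZMod M => ((j.val : ℤ) - z) := by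
    intro i j h
    simp only [sub_left_inj, Nat.cast_inj] at h
    exact ZMod.val_injective _ h
  have h1 : ∀ j : ZMod M, (1 + |2 * (j.val : ℝ) - c|) ^ (-b)
      ≤ (1 + |(((j.val : ℤ) - z : ℤ) : ℝ)|) ^ (-b) := by
    intro j
    apply Real.rpow_le_rpow_of_nonpos (by positivity) _ (by linarith)
    suffices |(((j.val : ℤ) - z : ℤ) : ℝ)| ≤ |2 * (j.val : ℝ) - c| by linarith
    by_cases h0 : (j.val : ℤ) - z = 0
    · rw [h0]; simp
    · have h2 : (1 : ℝ) ≤ |(((j.val : ℤ) - z : ℤ) : ℝ)| := by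
        rw [← Int.cast_abs]; exact_mod_cast Int.one_le_abs h0
      have e : 2 * (j.val : ℝ) - c = 2 * ((((j.val : ℤ) - z : ℤ) : ℝ) - (c / 2 - z)) := by
        push_cast; ring
      have h3 := abs_sub_abs_le_abs_sub (((j.val : ℤ) - z : ℤ) : ℝ) (c / 2 - z)
      rw [e, abs_mul, abs_two]
      linarith
  calc ∑ j : ZMod M, (1 + |2 * (j.val : ℝ) - c|) ^ (-b)
      ≤ ∑ j : ZMod M, (1 + |(((j.val : ℤ) - z : ℤ) : ℝ)|) ^ (-b) := sum_le_sum fun j _ => h1 j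
    _ = ∑ n ∈ univ.image (fun j : ZMod M => ((j.val : ℤ) - z)), (1 + |(n : ℝ)|) ^ (-b) := by
        rw [sum_image hinj.injOn]
    _ ≤ _ := (summable_one_add_abs_int hb).sum_le_tsum _ fun n _ => by positivity

lemma add_rpow_le_two_mul {x y b : ℝ} (hx : 0 ≤ x) (hy : 0 ≤ y) (hb : 0 ≤ b) :
    (x + y) ^ b ≤ (2 * x) ^ b + (2 * y) ^ b := by
  rcases le_total x y with h | h
  · have : (x + y) ^ b ≤ (2 * y) ^ b := Real.rpow_le_rpow (by positivity) (by linarith) hb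
    have : 0 ≤ (2 * x) ^ b := by positivity
    linarith
  · have : (x + y) ^ b ≤ (2 * x) ^ b := Real.rpow_le_rpow (by positivity) (by linarith) hb
    have : 0 ≤ (2 * y) ^ b := by positivity
    linarith

lemma one_add_log_le {R : ℝ} (hR : 1 ≤ R) : 1 + Real.log (4 * R) ≤ 37 * R ^ (1 / 9 : ℝ) := by
  have h1 := Real.log_le_rpow_div (x := 4 * R) (ε := 1 / 9) (by linarith) (by norm_num)
  have h2 : (1 : ℝ) ≤ R ^ (1 / 9 : ℝ) := Real.one_le_rpow hR (by norm_num)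
  have h3 : (4 * R) ^ (1 / 9 : ℝ) ≤ 4 * R ^ (1 / 9 : ℝ) := by
    rw [Real.mul_rpow (by norm_num) (by linarith)]
    gcongr
    calc (4 : ℝ) ^ (1 / 9 : ℝ) ≤ 4 ^ (1 : ℝ) :=
          Real.rpow_le_rpow_of_exponent_le (by norm_num) (by norm_num)
      _ = 4 := Real.rpow_one _
  have h4 : (4 * R) ^ (1 / 9 : ℝ) / (1 / 9) = 9 * (4 * R) ^ (1 / 9 : ℝ) := by ring
  linarith

lemma sqrt_norm_gaussSum_pow_le {R : ℕ} (hR : 0 < R) [NeZero (R ^ 2)] (j : ZMod (R ^ 2)) :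
    ∃ (q : ℕ) (a : ℤ), q ∈ Icc 1 (4 * R) ∧ a ∈ Icc (-1) (2 * (q : ℤ) + 1) ∧
      √‖gaussSum (R ^ 2) R j‖ ^ 9
        ≤ 72 ^ (9 / 4 : ℝ) * (R : ℝ) ^ (9 / 2 : ℝ) * ((q : ℝ) ^ (-(9 / 4) : ℝ)
            * (1 + |2 * (j.val : ℝ) - a * R ^ 2 / q|) ^ (-(9 / 8) : ℝ))
          + 2000 ^ (9 / 4 : ℝ) * (R : ℝ) ^ (5 / 2 : ℝ) := by
  obtain ⟨q, a, hq, hq4, hβ, h⟩ := norm_gaussSum_sq_le_rational hR j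
  have hRR : (1 : ℝ) ≤ R := by exact_mod_cast hR
  have hR0 : (0 : ℝ) < R := by linarith
  have hqR : (0 : ℝ) < q := by exact_mod_cast hq
  push_cast at h hβ
  refine ⟨q, a, mem_Icc.2 ⟨hq, hq4⟩, ?_, ?_⟩
  · have hv : (j.val : ℝ) < R ^ 2 := by exact_mod_cast ZMod.val_lt j
    have h0 : (0 : ℝ) ≤ 2 * j.val / R ^ 2 := by positivity
    have h2 : 2 * (j.val : ℝ) / R ^ 2 < 2 := by
      rw [div_lt_iff₀ (by positivity)]; linarith
    obtain ⟨b1, b2⟩ := abs_le.1 hβ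
    have e : (a : ℝ) / q * q = a := by field_simp
    have e' : 1 / (q : ℝ) * q = 1 := by field_simp
    rw [mem_Icc]
    constructor
    · have : (-1 : ℝ) ≤ a := by
        have := mul_le_mul_of_nonneg_right (by linarith : -(1 / (q : ℝ)) ≤ a / q) hqR.le
        linarith
      exact_mod_cast this
    · have : (a : ℝ) ≤ 2 * q + 1 := by
        have := mul_le_mul_of_nonneg_right (by linarith : (a : ℝ) / q ≤ 2 + 1 / q) hqR.le
        linarith
      exact_mod_cast this
  · set s := √‖gaussSum (R ^ 2) R j‖ with hs
    have hs0 : 0 ≤ s := Real.sqrt_nonneg _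
    have hs4 : s ^ 4 = ‖gaussSum (R ^ 2) R j‖ ^ 2 := by
      rw [hs, show 4 = 2 * 2 from rfl, pow_mul, Real.sq_sqrt (norm_nonneg _)]
    have hs9 : s ^ 9 = (s ^ 4) ^ (9 / 4 : ℝ) := by
      rw [← Real.rpow_natCast s 4, ← Real.rpow_mul hs0, ← Real.rpow_natCast]
      norm_num
    set y := |2 * (j.val : ℝ) - a * R ^ 2 / q| with hy
    have hy0 : 0 ≤ y := abs_nonneg _
    have hye : (R : ℝ) ^ 2 * |(2 * j.val / R ^ 2 : ℝ) - a / q| = y := by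
      rw [hy, ← abs_of_pos (by positivity : (0 : ℝ) < R ^ 2), ← abs_mul,
        abs_of_pos (by positivity : (0 : ℝ) < R ^ 2)]
      congr 1
      field_simp
    rw [hye] at h
    have hB : 27 * R * (1 + Real.log (4 * R)) ≤ 1000 * (R : ℝ) ^ (10 / 9 : ℝ) := by
      have e : (R : ℝ) ^ (10 / 9 : ℝ) = R * R ^ (1 / 9 : ℝ) := by
        rw [show (10 / 9 : ℝ) = 1 + 1 / 9 by norm_num, Real.rpow_add hR0, Real.rpow_one]
      rw [e]
      have h1 := one_add_log_le hRR
      have h2 : 0 < (R : ℝ) * R ^ (1 / 9 : ℝ) := by positivity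
      calc 27 * (R : ℝ) * (1 + Real.log (4 * R)) ≤ 27 * R * (37 * R ^ (1 / 9 : ℝ)) := by gcongr
        _ ≤ _ := by linarith
    have h1 : s ^ 4 ≤ 36 * (R ^ 2 / q) / √(1 + y) + 1000 * (R : ℝ) ^ (10 / 9 : ℝ) := by
      rw [hs4]; linarith
    rw [hs9]
    refine (Real.rpow_le_rpow (by positivity) h1 (by norm_num)).trans ?_
    refine (add_rpow_le_two_mul (by positivity) (by positivity) (by norm_num)).trans ?_
    refine add_le_add (le_of_eq ?_) (le_of_eq ?_)
    · have e : 2 * (36 * ((R : ℝ) ^ 2 / q) / √(1 + y))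
          = 72 * R ^ (2 : ℝ) * ((q : ℝ) ^ (-1 : ℝ) * (1 + y) ^ (-(1 / 2) : ℝ)) := by
        rw [Real.sqrt_eq_rpow, Real.rpow_neg_one, Real.rpow_neg (by positivity), Real.rpow_two]
        field_simp
        ring
      rw [e, Real.mul_rpow (by positivity) (by positivity),
        Real.mul_rpow (by positivity) (by positivity),
        Real.mul_rpow (by positivity) (by positivity), ← Real.rpow_mul (by positivity),
        ← Real.rpow_mul (by positivity), ← Real.rpow_mul (by positivity)]
      norm_num
    · have e : 2 * (1000 * (R : ℝ) ^ (10 / 9 : ℝ)) = 2000 * (R : ℝ) ^ (10 / 9 : ℝ) := by ring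
      rw [e, Real.mul_rpow (by positivity) (by positivity), ← Real.rpow_mul (by positivity)]
      norm_num

/-- The `9/2`-th moment of the quadratic exponential sum. -/
lemma exists_sum_sqrt_norm_gaussSum_pow_le :
    ∃ C : ℝ, 0 < C ∧ ∀ (R : ℕ) (_ : 0 < R) [NeZero (R ^ 2)],
      ∑ j : ZMod (R ^ 2), √‖gaussSum (R ^ 2) R j‖ ^ 9 ≤ C * √(R : ℝ) ^ 9 := by
  set D := ∑' n : ℤ, (1 + |(n : ℝ)|) ^ (-(9 / 8) : ℝ) with hD
  set E := ∑' q : ℕ, ((q : ℝ) ^ (5 / 4 : ℝ))⁻¹ with hE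
  have hD0 : 0 ≤ D := tsum_nonneg fun _ => by positivity
  have hE0 : 0 ≤ E := tsum_nonneg fun _ => by positivity
  refine ⟨72 ^ (9 / 4 : ℝ) * (5 * E * D) + 2000 ^ (9 / 4 : ℝ), by positivity, ?_⟩
  intro R hR _
  have hR0 : (0 : ℝ) < R := by exact_mod_cast hR
  have hpow : √(R : ℝ) ^ 9 = (R : ℝ) ^ (9 / 2 : ℝ) := by
    rw [Real.sqrt_eq_rpow, ← Real.rpow_natCast, ← Real.rpow_mul hR0.le]; norm_num
  have hpow2 : (R : ℝ) ^ (9 / 2 : ℝ) = R ^ 2 * (R : ℝ) ^ (5 / 2 : ℝ) := by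
    rw [show (9 / 2 : ℝ) = 2 + 5 / 2 by norm_num, Real.rpow_add hR0, Real.rpow_two]
  set G : ZMod (R ^ 2) → ℕ → ℤ → ℝ := fun j q a => (q : ℝ) ^ (-(9 / 4) : ℝ)
    * (1 + |2 * (j.val : ℝ) - a * R ^ 2 / q|) ^ (-(9 / 8) : ℝ) with hG
  have hG0 : ∀ j q a, 0 ≤ G j q a := fun j q a => by positivity
  have hpt : ∀ j : ZMod (R ^ 2), √‖gaussSum (R ^ 2) R j‖ ^ 9
      ≤ 72 ^ (9 / 4 : ℝ) * (R : ℝ) ^ (9 / 2 : ℝ)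
          * (∑ q ∈ Icc 1 (4 * R), ∑ a ∈ Icc (-1) (2 * (q : ℤ) + 1), G j q a)
        + 2000 ^ (9 / 4 : ℝ) * (R : ℝ) ^ (5 / 2 : ℝ) := by
    intro j
    obtain ⟨q, a, hq, ha, h⟩ := sqrt_norm_gaussSum_pow_le hR j
    refine h.trans ?_
    gcongr
    refine le_trans ?_ (single_le_sum (f := fun q : ℕ =>
      ∑ a ∈ Icc (-1) (2 * (q : ℤ) + 1), G j q a) (fun q _ => sum_nonneg fun a _ => hG0 j q a) hq)
    exact single_le_sum (f := fun a => G j q a) (fun a _ => hG0 j q a) ha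
  have hsumG : ∑ j : ZMod (R ^ 2), ∑ q ∈ Icc 1 (4 * R), ∑ a ∈ Icc (-1) (2 * (q : ℤ) + 1), G j q a
      ≤ 5 * E * D := by
    rw [sum_comm]
    calc ∑ q ∈ Icc 1 (4 * R), ∑ j : ZMod (R ^ 2), ∑ a ∈ Icc (-1) (2 * (q : ℤ) + 1), G j q a
        ≤ ∑ q ∈ Icc 1 (4 * R), 5 * ((q : ℝ) ^ (5 / 4 : ℝ))⁻¹ * D := by
          refine sum_le_sum fun q hq => ?_
          have hq1 : (1 : ℝ) ≤ q := by exact_mod_cast (mem_Icc.1 hq).1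
          rw [sum_comm]
          have h1 : ∀ a ∈ Icc (-1) (2 * (q : ℤ) + 1), ∑ j : ZMod (R ^ 2), G j q a
              ≤ (q : ℝ) ^ (-(9 / 4) : ℝ) * D := by
            intro a _
            simp only [hG]
            rw [← mul_sum]
            gcongr
            exact sum_one_add_abs_le (by norm_num) _
          refine (sum_le_card_nsmul _ _ _ h1).trans ?_
          rw [nsmul_eq_mul, Int.card_Icc, ← mul_assoc]
          refine mul_le_mul_of_nonneg_right ?_ hD0
          have h2 : (((2 * (q : ℤ) + 1 + 1 - (-1)).toNat : ℕ) : ℝ) ≤ 5 * q := by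
            have : (2 * (q : ℤ) + 1 + 1 - (-1)).toNat ≤ 5 * q := by
              have := (mem_Icc.1 hq).1
              omega
            exact_mod_cast this
          calc _ ≤ 5 * (q : ℝ) * (q : ℝ) ^ (-(9 / 4) : ℝ) := by gcongr
            _ = 5 * ((q : ℝ) ^ (5 / 4 : ℝ))⁻¹ := by
              rw [← Real.rpow_neg (by positivity), mul_assoc]
              nth_rewrite 1 [← Real.rpow_one (q : ℝ)]
              rw [← Real.rpow_add (by positivity)]
              norm_num
      _ = 5 * (∑ q ∈ Icc 1 (4 * R), ((q : ℝ) ^ (5 / 4 : ℝ))⁻¹) * D := by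
          rw [mul_sum, sum_mul]
      _ ≤ 5 * E * D := by
          gcongr
          exact (Real.summable_nat_rpow_inv.2 (by norm_num)).sum_le_tsum _ fun _ _ => by positivity
  refine (sum_le_sum fun j _ => hpt j).trans ?_
  rw [sum_add_distrib, ← mul_sum, sum_const, card_univ, ZMod.card, nsmul_eq_mul, hpow]
  calc _ ≤ 72 ^ (9 / 4 : ℝ) * (R : ℝ) ^ (9 / 2 : ℝ) * (5 * E * D)
        + ((R ^ 2 : ℕ) : ℝ) * (2000 ^ (9 / 4 : ℝ) * (R : ℝ) ^ (5 / 2 : ℝ)) := by gcongr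
    _ = _ := by rw [hpow2]; push_cast; ring

/-- The box `{u ∈ ℤ^d : |u_i| ≤ R}`. -/
def box (d R : ℕ) : Finset (V d) := Fintype.piFinset fun _ => Icc (-(R : ℤ)) R

/-- The number of representations of `m` as a sum of `d` squares of integers at most `R` in
absolute value. -/
def rep (d R : ℕ) (m : ℤ) : ℕ := #{u ∈ box d R | ∑ i, u i ^ 2 = m}

lemma addChar_sum {A B ι : Type*} [AddCommMonoid A] [CommMonoid B] (ψ : AddChar A B)
    (s : Finset ι) (f : ι → A) : ψ (∑ i ∈ s, f i) = ∏ i ∈ s, ψ (f i) := by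
  induction s using Finset.cons_induction with
  | empty => simp
  | cons a s ha ih => rw [sum_cons, prod_cons, AddChar.map_add_eq_mul, ih]

lemma gaussSum_pow (d R : ℕ) (j : ZMod M) :
    gaussSum M R j ^ d
      = ∑ u ∈ box d R, (ZMod.stdAddChar (j * ((∑ i, u i ^ 2 : ℤ) : ZMod M)) : ℂ) := by
  rw [gaussSum, sum_pow', box]
  refine sum_congr rfl fun u _ => ?_
  push_cast
  rw [mul_sum]
  exact (addChar_sum ZMod.stdAddChar univ _).symm

lemma sum_stdAddChar_mul (b : ZMod M) :
    ∑ j : ZMod M, (ZMod.stdAddChar (j * b) : ℂ) = if b = 0 then (M : ℂ) else 0 := by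
  rw [AddChar.sum_mulShift b (ZMod.isPrimitive_stdAddChar M), ZMod.card]
  split_ifs <;> simp

lemma mul_rep_le (d R : ℕ) (m : ℤ) :
    (M : ℝ) * rep d R m ≤ ∑ j : ZMod M, ‖gaussSum M R j‖ ^ d := by
  have h : ∑ j : ZMod M, gaussSum M R j ^ d * (ZMod.stdAddChar (-(j * (m : ZMod M))) : ℂ)
      = M * #{u ∈ box d R | ((∑ i, u i ^ 2 : ℤ) : ZMod M) - m = 0} := by
    simp_rw [gaussSum_pow, sum_mul, ← AddChar.map_add_eq_mul]
    rw [sum_comm]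
    have : ∀ u : V d, ∀ j : ZMod M, j * ((∑ i, u i ^ 2 : ℤ) : ZMod M) + -(j * (m : ZMod M))
        = j * (((∑ i, u i ^ 2 : ℤ) : ZMod M) - m) := fun u j => by ring
    simp_rw [this, sum_stdAddChar_mul]
    rw [← sum_filter, sum_const, nsmul_eq_mul, mul_comm]
  have h1 : rep d R m ≤ #{u ∈ box d R | ((∑ i, u i ^ 2 : ℤ) : ZMod M) - m = 0} := by
    refine card_le_card fun u hu => ?_
    rw [mem_filter] at hu ⊢
    exact ⟨hu.1, by rw [hu.2, sub_self]⟩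
  calc (M : ℝ) * rep d R m
      ≤ M * #{u ∈ box d R | ((∑ i, u i ^ 2 : ℤ) : ZMod M) - m = 0} := by gcongr
    _ = ‖∑ j : ZMod M, gaussSum M R j ^ d * (ZMod.stdAddChar (-(j * (m : ZMod M))) : ℂ)‖ := by
        rw [h, norm_mul, Complex.norm_natCast, Complex.norm_natCast]
    _ ≤ _ := by
        refine (norm_sum_le _ _).trans (sum_le_sum fun j _ => ?_)
        rw [norm_mul, norm_stdAddChar, mul_one, norm_pow]

lemma sum_rep_cube_le_card (d R : ℕ) (T : Finset ℤ) :
    ∑ m ∈ T, rep d R m ^ 3 ≤ #{t ∈ box d R ×ˢ box d R ×ˢ box d R |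
      ∑ i, t.1 i ^ 2 = ∑ i, t.2.2 i ^ 2 ∧ ∑ i, t.2.1 i ^ 2 = ∑ i, t.2.2 i ^ 2} := by
  set P := {t ∈ box d R ×ˢ box d R ×ˢ box d R |
      ∑ i, t.1 i ^ 2 = ∑ i, t.2.2 i ^ 2 ∧ ∑ i, t.2.1 i ^ 2 = ∑ i, t.2.2 i ^ 2} with hP
  have h : ∀ m, rep d R m ^ 3 ≤ #{t ∈ P | ∑ i, t.1 i ^ 2 = m} := by
    intro m
    rw [pow_three, rep, ← card_product, ← card_product]
    refine card_le_card fun t ht => ?_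
    simp only [hP, mem_product, mem_filter] at ht ⊢
    obtain ⟨⟨a1, a2⟩, ⟨b1, b2⟩, c1, c2⟩ := ht
    exact ⟨⟨⟨a1, b1, c1⟩, a2.trans c2.symm, b2.trans c2.symm⟩, a2⟩
  calc _ ≤ ∑ m ∈ T, #{t ∈ P | ∑ i, t.1 i ^ 2 = m} := sum_le_sum fun m _ => h m
    _ ≤ _ := by
      rw [sum_card_fiberwise_eq_card_filter]
      exact card_filter_le _ _

lemma mul_sum_rep_cube_le (d R : ℕ) (T : Finset ℤ) :
    (M : ℝ) ^ 2 * ∑ m ∈ T, (rep d R m : ℝ) ^ 3 ≤ ∑ j : ZMod M, ∑ k : ZMod M,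
      ‖gaussSum M R j‖ ^ d * ‖gaussSum M R k‖ ^ d * ‖gaussSum M R (-(j + k))‖ ^ d := by
  set B := box d R ×ˢ box d R ×ˢ box d R with hB
  set Q : V d → ZMod M := fun u => ((∑ i, u i ^ 2 : ℤ) : ZMod M) with hQ
  set P := {t ∈ B | Q t.1 - Q t.2.2 = 0 ∧ Q t.2.1 - Q t.2.2 = 0} with hP
  have h : ∑ j : ZMod M, ∑ k : ZMod M, gaussSum M R j ^ d * gaussSum M R k ^ d
        * gaussSum M R (-(j + k)) ^ d = (M : ℂ) ^ 2 * #P := by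
    have e : ∀ j k : ZMod M, gaussSum M R j ^ d * gaussSum M R k ^ d
        * gaussSum M R (-(j + k)) ^ d = ∑ t ∈ B, (ZMod.stdAddChar (j * (Q t.1 - Q t.2.2)) : ℂ)
          * ZMod.stdAddChar (k * (Q t.2.1 - Q t.2.2)) := by
      intro j k
      rw [gaussSum_pow, gaussSum_pow, gaussSum_pow, mul_assoc, sum_mul_sum, ← sum_product',
        sum_mul_sum, ← sum_product']
      refine sum_congr rfl fun t _ => ?_
      simp only [← AddChar.map_add_eq_mul, hQ]
      congr 1
      ring
    calc _ = ∑ j : ZMod M, ∑ t ∈ B, ∑ k : ZMod M,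
            (ZMod.stdAddChar (j * (Q t.1 - Q t.2.2)) : ℂ)
            * ZMod.stdAddChar (k * (Q t.2.1 - Q t.2.2)) := by
          refine sum_congr rfl fun j _ => ?_
          rw [sum_comm]
          exact sum_congr rfl fun k _ => e j k
      _ = ∑ t ∈ B, (∑ j : ZMod M, (ZMod.stdAddChar (j * (Q t.1 - Q t.2.2)) : ℂ))
            * ∑ k : ZMod M, (ZMod.stdAddChar (k * (Q t.2.1 - Q t.2.2)) : ℂ) := by
          rw [sum_comm]
          exact sum_congr rfl fun t _ => (sum_mul_sum _ _ _ _).symm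
      _ = ∑ t ∈ B, if Q t.1 - Q t.2.2 = 0 ∧ Q t.2.1 - Q t.2.2 = 0 then (M : ℂ) ^ 2 else 0 := by
          refine sum_congr rfl fun t _ => ?_
          rw [sum_stdAddChar_mul, sum_stdAddChar_mul, ite_zero_mul_ite_zero, sq]
      _ = _ := by rw [← sum_filter, sum_const, nsmul_eq_mul, mul_comm]
  have h1 : ∑ m ∈ T, rep d R m ^ 3 ≤ #P := by
    refine (sum_rep_cube_le_card d R T).trans (card_le_card fun t ht => ?_)
    simp only [hP, mem_filter, hQ, hB] at ht ⊢
    exact ⟨ht.1, by rw [ht.2.1, sub_self], by rw [ht.2.2, sub_self]⟩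
  calc (M : ℝ) ^ 2 * ∑ m ∈ T, (rep d R m : ℝ) ^ 3 ≤ (M : ℝ) ^ 2 * #P := by
        gcongr
        exact_mod_cast h1
    _ = ‖∑ j : ZMod M, ∑ k : ZMod M, gaussSum M R j ^ d * gaussSum M R k ^ d
        * gaussSum M R (-(j + k)) ^ d‖ := by
        rw [h, norm_mul, norm_pow, Complex.norm_natCast, Complex.norm_natCast]
    _ ≤ _ := by
        refine (norm_sum_le _ _).trans (sum_le_sum fun j _ => ?_)
        refine (norm_sum_le _ _).trans (sum_le_sum fun k _ => ?_)
        rw [norm_mul, norm_mul, norm_pow, norm_pow, norm_pow]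

lemma mul_le_cubes {x y z : ℝ} (hx : 0 ≤ x) (hy : 0 ≤ y) (hz : 0 ≤ z) :
    (x * y * z) ^ 6 ≤ (x * y) ^ 9 + (y * z) ^ 9 + (x * z) ^ 9 := by
  have key : ∀ a b c : ℝ, 0 ≤ a → 0 ≤ b → 0 ≤ c → a * b * c ≤ a ^ 3 + b ^ 3 + c ^ 3 := by
    intro a b c ha hb hc
    have e : a ^ 3 + b ^ 3 + c ^ 3 - 3 * (a * b * c)
        = (a + b + c) * ((a - b) ^ 2 + (b - c) ^ 2 + (c - a) ^ 2) / 2 := by ring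
    have h : 0 ≤ (a + b + c) * ((a - b) ^ 2 + (b - c) ^ 2 + (c - a) ^ 2) / 2 := by positivity
    have h2 : 0 ≤ a * b * c := by positivity
    linarith
  calc (x * y * z) ^ 6 = (x * y) ^ 3 * (y * z) ^ 3 * (x * z) ^ 3 := by ring
    _ ≤ ((x * y) ^ 3) ^ 3 + ((y * z) ^ 3) ^ 3 + ((x * z) ^ 3) ^ 3 :=
      key _ _ _ (by positivity) (by positivity) (by positivity)
    _ = _ := by ring

/-- A uniform third moment bound for the number of representations, in dimension `e + 3`. -/
lemma exists_sum_rep_cube_le (e : ℕ) : ∃ C : ℝ, 0 < C ∧ ∀ R : ℕ, 0 < R → ∀ T : Finset ℤ,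
    ∑ m ∈ T, (rep (e + 3) R m : ℝ) ^ 3 ≤ C * (R : ℝ) ^ (3 * e + 5) := by
  obtain ⟨C, hC, h⟩ := exists_sum_sqrt_norm_gaussSum_pow_le
  refine ⟨3 ^ (3 * e) * (3 * C ^ 2), by positivity, fun R hR T => ?_⟩
  have : NeZero (R ^ 2) := ⟨by positivity⟩
  specialize h R hR
  have hR1 : (1 : ℝ) ≤ R := by exact_mod_cast hR
  set s : ZMod (R ^ 2) → ℝ := fun j => √‖gaussSum (R ^ 2) R j‖ with hs
  have hs0 : ∀ j, 0 ≤ s j := fun j => Real.sqrt_nonneg _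
  set Z := ∑ j, s j ^ 9 with hZ
  have hZ0 : 0 ≤ Z := sum_nonneg fun j _ => pow_nonneg (hs0 j) _
  have hb : ∀ j, ‖gaussSum (R ^ 2) R j‖ ^ (e + 3) ≤ (3 * R) ^ e * s j ^ 6 := by
    intro j
    have h1 : s j ^ 6 = ‖gaussSum (R ^ 2) R j‖ ^ 3 := by
      rw [show 6 = 2 * 3 from rfl, pow_mul, hs, Real.sq_sqrt (norm_nonneg _)]
    rw [h1, pow_add]
    have := norm_gaussSum_le R j
    gcongr
    linarith
  have hpt : ∀ j k, ‖gaussSum (R ^ 2) R j‖ ^ (e + 3) * ‖gaussSum (R ^ 2) R k‖ ^ (e + 3)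
      * ‖gaussSum (R ^ 2) R (-(j + k))‖ ^ (e + 3)
      ≤ (3 * R) ^ (3 * e) * (s j ^ 9 * s k ^ 9 + s k ^ 9 * s (-(j + k)) ^ 9
        + s j ^ 9 * s (-(j + k)) ^ 9) := by
    intro j k
    calc _ ≤ ((3 * R) ^ e * s j ^ 6) * ((3 * R) ^ e * s k ^ 6)
            * ((3 * R) ^ e * s (-(j + k)) ^ 6) := by
          have := hb j
          have := hb k
          have := hb (-(j + k))
          gcongr
      _ = (3 * R) ^ (3 * e) * (s j * s k * s (-(j + k))) ^ 6 := by
          rw [mul_comm 3 e, pow_mul]; ring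
      _ ≤ _ := by
          rw [← mul_pow, ← mul_pow, ← mul_pow]
          exact mul_le_mul_of_nonneg_left (mul_le_cubes (hs0 _) (hs0 _) (hs0 _)) (by positivity)
  have hre : ∀ k, ∑ j, s (-(j + k)) ^ 9 = Z := fun k =>
    Equiv.sum_comp ((Equiv.addRight k).trans (Equiv.neg _)) fun j => s j ^ 9
  have hre' : ∀ j, ∑ k, s (-(j + k)) ^ 9 = Z := fun j =>
    Equiv.sum_comp ((Equiv.addLeft j).trans (Equiv.neg _)) fun j => s j ^ 9
  have e1 : ∑ j, ∑ k, s j ^ 9 * s k ^ 9 = Z ^ 2 := by rw [← sum_mul_sum]; exact (sq Z).symm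
  have e2 : ∑ j, ∑ k, s k ^ 9 * s (-(j + k)) ^ 9 = Z ^ 2 := by
    rw [sum_comm]
    simp_rw [← mul_sum, hre, ← sum_mul]
    exact (sq Z).symm
  have e3 : ∑ j, ∑ k, s j ^ 9 * s (-(j + k)) ^ 9 = Z ^ 2 := by
    simp_rw [← mul_sum, hre', ← sum_mul]
    exact (sq Z).symm
  have h1 : ((R ^ 2 : ℕ) : ℝ) ^ 2 * ∑ m ∈ T, (rep (e + 3) R m : ℝ) ^ 3
      ≤ (3 * R) ^ (3 * e) * (3 * Z ^ 2) := by
    refine (mul_sum_rep_cube_le (e + 3) R T).trans ?_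
    refine (sum_le_sum fun j _ => sum_le_sum fun k _ => hpt j k).trans (le_of_eq ?_)
    simp_rw [← mul_sum, sum_add_distrib]
    rw [e1, e2, e3]
    ring
  have h2 : Z ^ 2 ≤ C ^ 2 * (R : ℝ) ^ 9 := by
    calc Z ^ 2 ≤ (C * √(R : ℝ) ^ 9) ^ 2 := pow_le_pow_left₀ hZ0 h 2
      _ = C ^ 2 * (√(R : ℝ) ^ 2) ^ 9 := by ring
      _ = _ := by rw [Real.sq_sqrt (by positivity)]
  have hR4 : (0 : ℝ) < (R : ℝ) ^ 4 := by positivity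
  refine le_of_mul_le_mul_left ?_ hR4
  calc (R : ℝ) ^ 4 * ∑ m ∈ T, (rep (e + 3) R m : ℝ) ^ 3
      = ((R ^ 2 : ℕ) : ℝ) ^ 2 * ∑ m ∈ T, (rep (e + 3) R m : ℝ) ^ 3 := by push_cast; ring
    _ ≤ (3 * R) ^ (3 * e) * (3 * (C ^ 2 * (R : ℝ) ^ 9)) := h1.trans (by gcongr)
    _ = _ := by rw [mul_pow]; ring

/-- A uniform bound for the number of representations, in dimension `e + 5`. -/
lemma exists_rep_le (e : ℕ) : ∃ C : ℝ, 0 < C ∧ ∀ R : ℕ, 0 < R → ∀ m : ℤ,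
    (rep (e + 5) R m : ℝ) ≤ C * (R : ℝ) ^ (e + 3) := by
  obtain ⟨C, hC, h⟩ := exists_sum_sqrt_norm_gaussSum_pow_le
  refine ⟨3 ^ e * √3 * C, by positivity, fun R hR m => ?_⟩
  have : NeZero (R ^ 2) := ⟨by positivity⟩
  specialize h R hR
  have hR1 : (1 : ℝ) ≤ R := by exact_mod_cast hR
  have hb : ∀ j, ‖gaussSum (R ^ 2) R j‖ ^ (e + 5)
      ≤ (3 * R) ^ e * √(3 * R) * √‖gaussSum (R ^ 2) R j‖ ^ 9 := by
    intro j
    have hn : ‖gaussSum (R ^ 2) R j‖ ≤ 3 * R := (norm_gaussSum_le R j).trans (by linarith)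
    have h1 : ‖gaussSum (R ^ 2) R j‖ ^ 5
        = √‖gaussSum (R ^ 2) R j‖ * √‖gaussSum (R ^ 2) R j‖ ^ 9 := by
      rw [← pow_succ', show 9 + 1 = 2 * 5 from rfl, pow_mul, Real.sq_sqrt (norm_nonneg _)]
    rw [pow_add, h1, ← mul_assoc]
    gcongr
  have h1 : ((R ^ 2 : ℕ) : ℝ) * rep (e + 5) R m ≤ (3 * R) ^ e * √(3 * R) * (C * √(R : ℝ) ^ 9) := by
    refine (mul_rep_le (e + 5) R m).trans ((sum_le_sum fun j _ => hb j).trans ?_)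
    rw [← mul_sum]
    gcongr
  have hR2 : (0 : ℝ) < (R : ℝ) ^ 2 := by positivity
  refine le_of_mul_le_mul_left ?_ hR2
  calc (R : ℝ) ^ 2 * rep (e + 5) R m = ((R ^ 2 : ℕ) : ℝ) * rep (e + 5) R m := by push_cast; ring
    _ ≤ _ := h1
    _ = 3 ^ e * √3 * C * ((R : ℝ) ^ e * (√(R : ℝ) ^ 2) ^ 5) := by
        rw [Real.sqrt_mul (by norm_num), mul_pow]; ring
    _ = _ := by rw [Real.sq_sqrt (by positivity)]; ring

/-- The Hardy–Littlewood maximal function over centred cubes of `ℤ^d`. -/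
def hlMax (d : ℕ) (F : V d → ℝ≥0∞) (x : V d) : ℝ≥0∞ :=
  ⨆ n : ℕ, (∑ u ∈ box d n, F (x - u)) / ((n : ℝ≥0∞) + 1) ^ d

/-- The cube of side `2 n` centred at `x`. -/
def cube (d n : ℕ) (x : V d) : Finset (V d) := (box d n).map (Equiv.subLeft x).toEmbedding

lemma card_box (d n : ℕ) : #(box d n) = (2 * n + 1) ^ d := by
  rw [box, Fintype.card_piFinset, prod_const, card_univ, Fintype.card_fin, Int.card_Icc]
  congr 1
  omega

lemma card_cube (d n : ℕ) (x : V d) : #(cube d n x) = (2 * n + 1) ^ d := by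
  rw [cube, card_map, card_box]

lemma sum_cube (d n : ℕ) (x : V d) (F : V d → ℝ≥0∞) :
    ∑ y ∈ cube d n x, F y = ∑ u ∈ box d n, F (x - u) := by
  rw [cube, sum_map]; rfl

lemma coe_cube (d n : ℕ) (x : V d) : (cube d n x : Set (V d)) = Metric.closedBall x n := by
  ext y
  have h : y ∈ cube d n x ↔ x - y ∈ box d n := by
    rw [cube, mem_map]
    constructor
    · rintro ⟨u, hu, rfl⟩
      simpa using hu
    · intro h
      exact ⟨_, h, by simp⟩
  rw [mem_coe, h, Metric.mem_closedBall, dist_pi_le_iff (by positivity), box,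
    Fintype.mem_piFinset]
  refine forall_congr' fun i => ?_
  rw [Int.dist_eq, mem_Icc, Pi.sub_apply, abs_sub_comm, ← Int.cast_sub, ← Int.cast_abs,
    ← abs_le]
  exact_mod_cast Iff.rfl

lemma mul_card_le_tsum (d : ℕ) (F : V d → ℝ≥0∞) (t : ℝ≥0∞) (S : Finset (V d))
    (hS : ∀ x ∈ S, t < hlMax d F x) : t * #S ≤ 10 ^ d * ∑' x, F x := by
  have hex : ∀ x, ∃ n : ℕ, x ∈ S → t * ((n : ℝ≥0∞) + 1) ^ d ≤ ∑ y ∈ cube d n x, F y := by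
    intro x
    by_cases hx : x ∈ S
    · obtain ⟨n, hn⟩ := lt_iSup_iff.1 (hS x hx)
      refine ⟨n, fun _ => ?_⟩
      rw [sum_cube]
      exact ((ENNReal.lt_div_iff_mul_lt (Or.inl (by positivity))
        (Or.inl (ENNReal.pow_ne_top (by finiteness)))).1 hn).le
    · exact ⟨0, fun h => absurd h hx⟩
  choose n hn using hex
  obtain ⟨u, huS, hdisj, hcov⟩ := Vitali.exists_disjoint_subfamily_covering_enlargement_closedBall
    (S : Set (V d)) id (fun x => (n x : ℝ)) (∑ x ∈ S, (n x : ℝ))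
    (fun a ha => single_le_sum (f := fun x => (n x : ℝ)) (fun _ _ => by positivity)
      (mem_coe.1 ha)) 5 (by norm_num)
  set U := (S.finite_toSet.subset huS).toFinset with hU
  have hUm : ∀ {x}, x ∈ U ↔ x ∈ u := by simp [hU]
  have hcov' : S ⊆ U.biUnion fun b => cube d (5 * n b) b := by
    intro a ha
    obtain ⟨b, hb, hab⟩ := hcov a ha
    rw [mem_biUnion]
    refine ⟨b, hUm.2 hb, ?_⟩
    have : a ∈ (cube d (5 * n b) b : Set (V d)) := by
      rw [coe_cube]
      push_cast
      exact hab (Metric.mem_closedBall_self (by positivity))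
    exact this
  have hcard : (#S : ℝ≥0∞) ≤ ∑ b ∈ U, 10 ^ d * ((n b : ℝ≥0∞) + 1) ^ d := by
    have h1 : #S ≤ ∑ b ∈ U, (10 * (n b + 1)) ^ d := by
      refine (card_le_card hcov').trans (card_biUnion_le.trans (sum_le_sum fun b _ => ?_))
      rw [card_cube]
      exact Nat.pow_le_pow_left (by omega) d
    calc (#S : ℝ≥0∞) ≤ ((∑ b ∈ U, (10 * (n b + 1)) ^ d : ℕ) : ℝ≥0∞) := by exact_mod_cast h1
      _ = _ := by push_cast; simp_rw [mul_pow]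
  have hdisj' : (U : Set (V d)).PairwiseDisjoint fun b => cube d (n b) b := by
    intro a ha b hb hab
    have := hdisj (hUm.1 ha) (hUm.1 hb) hab
    simp only [Function.onFun, id] at this ⊢
    rwa [← coe_cube, ← coe_cube, disjoint_coe] at this
  calc t * #S ≤ t * ∑ b ∈ U, 10 ^ d * ((n b : ℝ≥0∞) + 1) ^ d := by gcongr
    _ = 10 ^ d * ∑ b ∈ U, t * ((n b : ℝ≥0∞) + 1) ^ d := by
      rw [mul_sum, mul_sum]
      exact sum_congr rfl fun b _ => by ring
    _ ≤ 10 ^ d * ∑ b ∈ U, ∑ y ∈ cube d (n b) b, F y := by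
      gcongr with b hb
      exact hn b (huS (hUm.1 hb))
    _ = 10 ^ d * ∑ y ∈ U.biUnion fun b => cube d (n b) b, F y := by
      rw [sum_biUnion hdisj']
    _ ≤ _ := by
      gcongr
      exact ENNReal.sum_le_tsum _

/-- Weak type `(1,1)` bound. -/
lemma mul_tsum_indicator_le (d : ℕ) (F : V d → ℝ≥0∞) (t : ℝ≥0∞) :
    t * ∑' x, {x | t < hlMax d F x}.indicator 1 x ≤ 10 ^ d * ∑' x, F x := by
  classical
  rw [ENNReal.tsum_eq_iSup_sum, ENNReal.mul_iSup]
  refine iSup_le fun S => ?_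
  refine le_trans (le_of_eq ?_) (mul_card_le_tsum d F t {x ∈ S | t < hlMax d F x}
    fun x hx => (mem_filter.1 hx).2)
  simp only [Set.indicator_apply, Set.mem_ofPred_eq, Pi.one_apply]
  rw [sum_boole]

lemma hlMax_le_add (d : ℕ) {F G : V d → ℝ≥0∞} {a : ℝ≥0∞} (h : ∀ x, F x ≤ G x + a) (x : V d) :
    hlMax d F x ≤ hlMax d G x + 2 ^ d * a := by
  refine iSup_le fun n => ?_
  have hne : ((n : ℝ≥0∞) + 1) ^ d ≠ 0 := by positivity
  have hnt : ((n : ℝ≥0∞) + 1) ^ d ≠ ∞ := ENNReal.pow_ne_top (by finiteness)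
  calc (∑ u ∈ box d n, F (x - u)) / ((n : ℝ≥0∞) + 1) ^ d
      ≤ (∑ u ∈ box d n, (G (x - u) + a)) / ((n : ℝ≥0∞) + 1) ^ d := by
        gcongr with u _
        exact h _
    _ = (∑ u ∈ box d n, G (x - u)) / ((n : ℝ≥0∞) + 1) ^ d
        + (2 * n + 1) ^ d * a / ((n : ℝ≥0∞) + 1) ^ d := by
        rw [sum_add_distrib, sum_const, card_box, nsmul_eq_mul, ENNReal.add_div]
        push_cast
        rfl
    _ ≤ _ := by
        gcongr
        · exact le_iSup (fun n : ℕ => (∑ u ∈ box d n, G (x - u)) / ((n : ℝ≥0∞) + 1) ^ d) n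
        · rw [ENNReal.div_le_iff hne hnt]
          calc (2 * (n : ℝ≥0∞) + 1) ^ d * a ≤ (2 * (n + 1)) ^ d * a := by
                gcongr
                rw [mul_add, mul_one]
                gcongr
                norm_num
            _ = _ := by rw [mul_pow]; ring

/-- The weak type bound after truncation. -/
lemma mul_tsum_indicator_le_truncation (d : ℕ) (F : V d → ℝ≥0∞) (t : ℝ≥0∞) :
    t * ∑' x, {x | t < hlMax d F x}.indicator 1 x
      ≤ 2 * (10 ^ d * ∑' x, {x | t < 2 ^ (d + 1) * F x}.indicator F x) := by
  set G := {x | t < 2 ^ (d + 1) * F x}.indicator F with hG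
  have hF : ∀ x, F x ≤ G x + t / 2 ^ (d + 1) := by
    intro x
    by_cases hx : t < 2 ^ (d + 1) * F x
    · have : G x = F x := Set.indicator_of_mem (by exact hx) _
      rw [this]
      exact le_self_add
    · refine le_add_left ?_
      rw [ENNReal.le_div_iff_mul_le (Or.inl (by positivity))
        (Or.inl (ENNReal.pow_ne_top (by norm_num))), mul_comm]
      exact not_lt.1 hx
  have h2 : (2 : ℝ≥0∞) ^ d * (t / 2 ^ (d + 1)) = t / 2 := by
    rw [pow_succ, div_eq_mul_inv, ENNReal.mul_inv (Or.inl (by positivity)) (Or.inr (by norm_num)),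
      div_eq_mul_inv]
    calc (2 : ℝ≥0∞) ^ d * (t * ((2 ^ d)⁻¹ * 2⁻¹)) = (2 ^ d * (2 ^ d)⁻¹) * (t * 2⁻¹) := by ring
      _ = _ := by
        rw [ENNReal.mul_inv_cancel (by positivity) (ENNReal.pow_ne_top (by norm_num)), one_mul]
  have hsub : {x | t < hlMax d F x} ⊆ {x | t / 2 < hlMax d G x} := by
    intro x hx
    simp only [Set.mem_ofPred_eq] at hx ⊢
    by_contra hcon
    have h3 := hlMax_le_add d hF x
    rw [h2] at h3
    have : hlMax d F x ≤ t := by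
      refine h3.trans ?_
      calc _ ≤ t / 2 + t / 2 := by gcongr; exact not_lt.1 hcon
        _ = t := ENNReal.add_halves t
    exact absurd hx (not_lt.2 this)
  calc t * ∑' x, {x | t < hlMax d F x}.indicator 1 x
      ≤ t * ∑' x, {x | t / 2 < hlMax d G x}.indicator 1 x := by
        gcongr
    _ = 2 * (t / 2 * ∑' x, {x | t / 2 < hlMax d G x}.indicator 1 x) := by
        rw [← mul_assoc, ENNReal.mul_div_cancel (by norm_num) (by norm_num)]
    _ ≤ _ := by
        exact mul_le_mul_right (mul_tsum_indicator_le d G (t / 2)) _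

lemma rpow_le_tsum_zpow {s : ℝ} (hs : 1 < s) (a : ℝ≥0∞) :
    a ^ s ≤ ∑' k : ℤ, {k : ℤ | (2 : ℝ≥0∞) ^ k < a}.indicator
      (fun k => ((2 : ℝ≥0∞) ^ (k + 1)) ^ s) k := by
  have hs0 : 0 < s := by linarith
  rcases eq_or_ne a 0 with rfl | h0
  · rw [ENNReal.zero_rpow_of_pos hs0]; exact zero_le
  rcases eq_or_ne a ∞ with rfl | ht
  · refine le_of_le_of_eq le_top (ENNReal.eq_top_of_forall_nnreal_le fun r => ?_).symm
    obtain ⟨k, hk⟩ := exists_nat_ge r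
    refine le_trans ?_ (ENNReal.le_tsum (k : ℤ))
    have hlt : (2 : ℝ≥0∞) ^ (k : ℤ) < ∞ := by
      rw [zpow_natCast]; exact ENNReal.pow_lt_top (by norm_num)
    rw [Set.indicator_of_mem (by exact hlt)]
    have h1 : (1 : ℝ≥0∞) ≤ 2 ^ ((k : ℤ) + 1) := by
      rw [← Nat.cast_succ, zpow_natCast]; exact one_le_pow₀ (by norm_num)
    calc (r : ℝ≥0∞) ≤ ((k : ℝ≥0) : ℝ≥0∞) := by exact_mod_cast hk
      _ = ((k : ℕ) : ℝ≥0∞) := by simp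
      _ ≤ ((2 ^ (k + 1) : ℕ) : ℝ≥0∞) := by
        exact_mod_cast (Nat.lt_two_pow_self.le.trans (Nat.pow_le_pow_right (by norm_num)
          (Nat.le_succ k)))
      _ = 2 ^ ((k : ℤ) + 1) := by rw [← Nat.cast_succ, zpow_natCast]; push_cast; rfl
      _ = (2 ^ ((k : ℤ) + 1)) ^ (1 : ℝ) := (ENNReal.rpow_one _).symm
      _ ≤ _ := ENNReal.rpow_le_rpow_of_exponent_le h1 hs.le
  · obtain ⟨m, hm⟩ := ENNReal.exists_mem_Ioc_zpow h0 ht (y := 2) (by norm_num) (by norm_num)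
    refine le_trans ?_ (ENNReal.le_tsum m)
    rw [Set.indicator_of_mem (by exact hm.1)]
    exact ENNReal.rpow_le_rpow hm.2 hs0.le

lemma tsum_zpow_le {r : ℝ} (hr : 0 < r) (b : ℝ≥0∞) :
    ∑' k : ℤ, {k : ℤ | (2 : ℝ≥0∞) ^ k < b}.indicator (fun k => ((2 : ℝ≥0∞) ^ k) ^ r) k
      ≤ (1 - (2⁻¹ : ℝ≥0∞) ^ r)⁻¹ * b ^ r := by
  rcases eq_or_ne b 0 with rfl | h0
  · have : ∀ k : ℤ, {k : ℤ | (2 : ℝ≥0∞) ^ k < 0}.indicator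
        (fun k => ((2 : ℝ≥0∞) ^ k) ^ r) k = 0 := fun k =>
      Set.indicator_of_notMem (by simp) _
    simp_rw [this, tsum_zero]
    exact zero_le
  rcases eq_or_ne b ∞ with rfl | ht
  · rw [ENNReal.top_rpow_of_pos hr, ENNReal.mul_top]
    · exact le_top
    · exact ENNReal.inv_ne_zero.2 (ne_top_of_le_ne_top ENNReal.one_ne_top tsub_le_self)
  obtain ⟨m, hm⟩ := ENNReal.exists_mem_Ioc_zpow h0 ht (y := 2) (by norm_num) (by norm_num)
  have hinj : Function.Injective fun i : ℕ => m - (i : ℤ) := fun i j h => by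
    simpa using h
  have hsupp : Function.support ({k : ℤ | (2 : ℝ≥0∞) ^ k < b}.indicator
      fun k => ((2 : ℝ≥0∞) ^ k) ^ r) ⊆ Set.range fun i : ℕ => m - (i : ℤ) := by
    intro k hk
    have hk1 : (2 : ℝ≥0∞) ^ k < b := by
      by_contra hcon
      exact hk (Set.indicator_of_notMem (by exact hcon) _)
    have hkm : k ≤ m := by
      by_contra hcon
      have : (2 : ℝ≥0∞) ^ (m + 1) ≤ 2 ^ k := ENNReal.zpow_le_of_le (by norm_num) (by omega)
      exact absurd (hm.2.trans this) (not_le.2 hk1)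
    exact ⟨(m - k).toNat, by simp only; omega⟩
  rw [← hinj.tsum_eq hsupp]
  calc _ ≤ ∑' i : ℕ, b ^ r * ((2⁻¹ : ℝ≥0∞) ^ r) ^ i := by
        refine ENNReal.tsum_le_tsum fun i => ?_
        refine (Set.indicator_le_self _ _ _).trans ?_
        have e : (2 : ℝ≥0∞) ^ (m - (i : ℤ)) = 2 ^ m * (2⁻¹) ^ i := by
          rw [sub_eq_add_neg, ENNReal.zpow_add (by norm_num) (by norm_num), ENNReal.zpow_neg,
            zpow_natCast, ENNReal.inv_pow]
        have e2 : ((2⁻¹ : ℝ≥0∞) ^ r) ^ i = ((2⁻¹ : ℝ≥0∞) ^ i) ^ r := by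
          rw [← ENNReal.rpow_natCast, ← ENNReal.rpow_natCast, ← ENNReal.rpow_mul,
            ← ENNReal.rpow_mul, mul_comm]
        rw [e, ENNReal.mul_rpow_of_nonneg _ _ hr.le, e2]
        gcongr
        exact hm.1.le
    _ = _ := by rw [ENNReal.tsum_mul_left, ENNReal.tsum_geometric, mul_comm]

/-- The Hardy–Littlewood maximal function is bounded on `l^s`, `s > 1`. -/
lemma exists_tsum_hlMax_rpow_le (d : ℕ) {s : ℝ} (hs : 1 < s) :
    ∃ C : ℝ≥0, ∀ F : V d → ℝ≥0∞, ∑' x, hlMax d F x ^ s ≤ C * ∑' x, F x ^ s := by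
  have hr : 0 < s - 1 := by linarith
  set D := (1 - (2⁻¹ : ℝ≥0∞) ^ (s - 1))⁻¹ with hD
  have hDt : D ≠ ∞ := by
    rw [hD, ENNReal.inv_ne_top]
    exact (tsub_pos_of_lt (ENNReal.rpow_lt_one (by norm_num) hr)).ne'
  set C := (2 : ℝ≥0∞) ^ s * (2 * 10 ^ d) * (D * (2 ^ (d + 1)) ^ (s - 1)) with hC
  have hCt : C ≠ ∞ := by finiteness
  refine ⟨C.toNNReal, fun F => ?_⟩
  rw [ENNReal.coe_toNNReal hCt]
  have hk : ∀ k : ℤ, ((2 : ℝ≥0∞) ^ (k + 1)) ^ s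
      * ∑' x, {x | (2 : ℝ≥0∞) ^ k < hlMax d F x}.indicator 1 x
      ≤ 2 ^ s * (2 * 10 ^ d) * ∑' x, F x * {k : ℤ | (2 : ℝ≥0∞) ^ k < 2 ^ (d + 1) * F x}.indicator
          (fun k => ((2 : ℝ≥0∞) ^ k) ^ (s - 1)) k := by
    intro k
    have e1 : ((2 : ℝ≥0∞) ^ (k + 1)) ^ s = 2 ^ s * ((2 : ℝ≥0∞) ^ k) ^ (s - 1) * 2 ^ k := by
      rw [ENNReal.zpow_add (by norm_num) (by norm_num), zpow_one,
        ENNReal.mul_rpow_of_nonneg _ _ (by linarith), mul_comm, mul_assoc]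
      congr 1
      nth_rewrite 3 [← ENNReal.rpow_one ((2 : ℝ≥0∞) ^ k)]
      rw [← ENNReal.rpow_add_of_nonneg _ _ hr.le zero_le_one]
      ring_nf
    have e2 : ∀ x, F x * {k : ℤ | (2 : ℝ≥0∞) ^ k < 2 ^ (d + 1) * F x}.indicator
          (fun k => ((2 : ℝ≥0∞) ^ k) ^ (s - 1)) k
        = ((2 : ℝ≥0∞) ^ k) ^ (s - 1)
          * {x | (2 : ℝ≥0∞) ^ k < 2 ^ (d + 1) * F x}.indicator F x := by
      intro x
      simp only [Set.indicator_apply, Set.mem_ofPred_eq]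
      split_ifs
      · rw [mul_comm]
      · simp
    simp_rw [e2]
    rw [ENNReal.tsum_mul_left, e1, mul_assoc]
    calc _ ≤ 2 ^ s * ((2 : ℝ≥0∞) ^ k) ^ (s - 1) * (2 * (10 ^ d
            * ∑' x, {x | (2 : ℝ≥0∞) ^ k < 2 ^ (d + 1) * F x}.indicator F x)) := by
          exact mul_le_mul_right (mul_tsum_indicator_le_truncation d F (2 ^ k)) _
      _ = _ := by ring
  calc ∑' x, hlMax d F x ^ s
      ≤ ∑' x, ∑' k : ℤ, {k : ℤ | (2 : ℝ≥0∞) ^ k < hlMax d F x}.indicator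
          (fun k => ((2 : ℝ≥0∞) ^ (k + 1)) ^ s) k :=
        ENNReal.tsum_le_tsum fun x => rpow_le_tsum_zpow hs _
    _ = ∑' k : ℤ, ((2 : ℝ≥0∞) ^ (k + 1)) ^ s
          * ∑' x, {x | (2 : ℝ≥0∞) ^ k < hlMax d F x}.indicator 1 x := by
        rw [ENNReal.tsum_comm]
        refine tsum_congr fun k => ?_
        rw [← ENNReal.tsum_mul_left]
        refine tsum_congr fun x => ?_
        simp only [Set.indicator_apply, Set.mem_ofPred_eq, Pi.one_apply]
        split_ifs <;> simp
    _ ≤ ∑' k : ℤ, 2 ^ s * (2 * 10 ^ d) * ∑' x, F x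
          * {k : ℤ | (2 : ℝ≥0∞) ^ k < 2 ^ (d + 1) * F x}.indicator
            (fun k => ((2 : ℝ≥0∞) ^ k) ^ (s - 1)) k := ENNReal.tsum_le_tsum hk
    _ = 2 ^ s * (2 * 10 ^ d) * ∑' x, F x * ∑' k : ℤ,
          {k : ℤ | (2 : ℝ≥0∞) ^ k < 2 ^ (d + 1) * F x}.indicator
            (fun k => ((2 : ℝ≥0∞) ^ k) ^ (s - 1)) k := by
        rw [ENNReal.tsum_mul_left, ENNReal.tsum_comm]
        simp_rw [ENNReal.tsum_mul_left]
    _ ≤ 2 ^ s * (2 * 10 ^ d) * ∑' x, F x * (D * (2 ^ (d + 1) * F x) ^ (s - 1)) := by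
        gcongr with x
        exact tsum_zpow_le hr _
    _ = C * ∑' x, F x ^ s := by
        have : ∀ x, F x * (D * (2 ^ (d + 1) * F x) ^ (s - 1))
            = D * (2 ^ (d + 1)) ^ (s - 1) * F x ^ s := by
          intro x
          have : F x ^ s = F x * F x ^ (s - 1) := by
            nth_rewrite 2 [← ENNReal.rpow_one (F x)]
            rw [← ENNReal.rpow_add_of_nonneg _ _ zero_le_one hr.le]
            ring_nf
          rw [ENNReal.mul_rpow_of_nonneg _ _ hr.le, this]
          ring
        simp_rw [this]
        rw [ENNReal.tsum_mul_left, hC, mul_assoc (2 ^ s * (2 * 10 ^ d))]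

lemma coe_filter_box_eq_sph (d lam : ℕ) :
    (({t ∈ box d (lam.sqrt + 1) ×ˢ box d (lam.sqrt + 1) |
      ∑ i, t.1 i ^ 2 + ∑ i, t.2 i ^ 2 = (lam : ℤ)} : Finset (V d × V d)) : Set (V d × V d))
      = sph d lam := by
  have key : ∀ u : V d, ∑ i, u i ^ 2 ≤ (lam : ℤ) → u ∈ box d (lam.sqrt + 1) := by
    intro u hu
    rw [box, Fintype.mem_piFinset]
    intro i
    have h1 : u i ^ 2 ≤ lam :=
      (single_le_sum (f := fun i => u i ^ 2) (fun j _ => sq_nonneg _) (mem_univ i)).trans hu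
    have h2 : (lam : ℤ) < (lam.sqrt + 1) * (lam.sqrt + 1) := by
      exact_mod_cast Nat.lt_succ_sqrt lam
    have := abs_le_of_sq_le_sq (a := u i) (b := ((lam.sqrt + 1 : ℕ) : ℤ))
      (by push_cast; nlinarith) (by positivity)
    exact mem_Icc.2 (abs_le.1 this)
  ext t
  simp only [coe_filter, mem_product, Set.mem_ofPred_eq, sph]
  refine ⟨fun h => h.2, fun h => ⟨⟨key _ ?_, key _ ?_⟩, h⟩⟩
  · have : 0 ≤ ∑ i, t.2 i ^ 2 := sum_nonneg fun _ _ => sq_nonneg _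
    linarith
  · have : 0 ≤ ∑ i, t.1 i ^ 2 := sum_nonneg fun _ _ => sq_nonneg _
    linarith

lemma nnnorm_avg_le (d lam : ℕ) (f g : V d → ℂ) (x : V d) :
    (‖avg d lam f g x‖₊ : ℝ≥0∞) ≤ (Ncount d lam : ℝ≥0∞)⁻¹ * (∑ u ∈ box d (lam.sqrt + 1),
      (rep d (lam.sqrt + 1) (lam - ∑ i, u i ^ 2) : ℝ≥0∞) * ‖f (x - u)‖₊) * linftyNorm d g := by
  rcases Nat.eq_zero_or_pos (Ncount d lam) with h0 | hN
  · rw [avg, h0]; simp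
  set B := box d (lam.sqrt + 1) with hB
  have hsum : ∑' uv : sph d lam, f (x - (uv : V d × V d).1) * g (x - (uv : V d × V d).2)
      = ∑ t ∈ B ×ˢ B with ∑ i, t.1 i ^ 2 + ∑ i, t.2 i ^ 2 = (lam : ℤ),
        f (x - t.1) * g (x - t.2) := by
    rw [← coe_filter_box_eq_sph]
    exact Finset.tsum_subtype' _ fun t : V d × V d => f (x - t.1) * g (x - t.2)
  have hfib : ∀ u, (rep d (lam.sqrt + 1) (lam - ∑ i, u i ^ 2) : ℝ≥0∞) * ‖f (x - u)‖₊
      = ∑ v ∈ B, if ∑ i, u i ^ 2 + ∑ i, v i ^ 2 = (lam : ℤ) then (‖f (x - u)‖₊ : ℝ≥0∞) else 0 := by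
    intro u
    rw [← sum_filter, sum_const, nsmul_eq_mul, rep]
    congr 3
    refine filter_congr fun v _ => ?_
    constructor <;> intro h <;> linarith
  rw [avg, hsum, nnnorm_mul, ENNReal.coe_mul, nnnorm_inv, mul_assoc]
  have hNn : ((‖(Ncount d lam : ℂ)‖₊⁻¹ : ℝ≥0) : ℝ≥0∞) = (Ncount d lam : ℝ≥0∞)⁻¹ := by
    rw [RCLike.nnnorm_natCast, ENNReal.coe_inv (by positivity)]
    simp
  rw [hNn]
  gcongr
  calc ((‖∑ t ∈ B ×ˢ B with ∑ i, t.1 i ^ 2 + ∑ i, t.2 i ^ 2 = (lam : ℤ),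
        f (x - t.1) * g (x - t.2)‖₊ : ℝ≥0) : ℝ≥0∞)
      ≤ ∑ t ∈ B ×ˢ B with ∑ i, t.1 i ^ 2 + ∑ i, t.2 i ^ 2 = (lam : ℤ),
        (‖f (x - t.1)‖₊ : ℝ≥0∞) * ‖g (x - t.2)‖₊ := by
        refine le_trans (ENNReal.coe_le_coe.2 (nnnorm_sum_le _ _)) (le_of_eq ?_)
        push_cast
        simp_rw [nnnorm_mul, ENNReal.coe_mul]
    _ ≤ ∑ t ∈ B ×ˢ B with ∑ i, t.1 i ^ 2 + ∑ i, t.2 i ^ 2 = (lam : ℤ),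
        (‖f (x - t.1)‖₊ : ℝ≥0∞) * linftyNorm d g := by
        gcongr with t
        exact le_iSup (fun y => (‖g y‖₊ : ℝ≥0∞)) _
    _ = _ := by
        simp_rw [hfib]
        rw [← sum_mul, sum_filter, sum_product]

lemma sum_rep_sq_le (d R : ℕ) (n : ℤ) {K : ℝ}
    (hK : ∀ T : Finset ℤ, ∑ m ∈ T, (rep d R m : ℝ) ^ 3 ≤ K) :
    ∑ u ∈ box d R, (rep d R (n - ∑ i, u i ^ 2) : ℝ) ^ 2 ≤ 2 * K := by
  have hxy : ∀ a b : ℝ, 0 ≤ a → 0 ≤ b → a * b ^ 2 ≤ a ^ 3 + b ^ 3 := by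
    intro a b ha hb
    rcases le_total a b with h | h
    · have : a * b ^ 2 ≤ b * b ^ 2 := by gcongr
      have : 0 ≤ a ^ 3 := by positivity
      linarith
    · have : a * b ^ 2 ≤ a * a ^ 2 := by gcongr
      have : 0 ≤ b ^ 3 := by positivity
      linarith
  rw [sum_comp (fun m : ℤ => (rep d R (n - m) : ℝ) ^ 2) fun u : V d => ∑ i, u i ^ 2]
  set T := (box d R).image fun u : V d => ∑ i, u i ^ 2 with hT
  calc _ ≤ ∑ m ∈ T, ((rep d R m : ℝ) ^ 3 + (rep d R (n - m) : ℝ) ^ 3) := by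
        refine sum_le_sum fun m _ => ?_
        rw [nsmul_eq_mul]
        exact hxy _ _ (Nat.cast_nonneg _) (Nat.cast_nonneg _)
    _ = ∑ m ∈ T, (rep d R m : ℝ) ^ 3
        + ∑ m ∈ T.map (Equiv.subLeft n).toEmbedding, (rep d R m : ℝ) ^ 3 := by
        rw [sum_add_distrib, sum_map]; rfl
    _ ≤ K + K := add_le_add (hK _) (hK _)
    _ = _ := by ring

lemma add_one_pow_le {R : ℝ} (hR : 1 ≤ R) (d : ℕ) : (R + 1) ^ d ≤ 2 ^ d * R ^ d := by
  rw [← mul_pow]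
  gcongr
  linarith

/-- Quadratic mean estimate for the averages in dimension `e + 3`. -/
lemma exists_sq_sum_rep_mul_le (e : ℕ) : ∃ C : ℝ≥0, ∀ lam : ℕ, 0 < Ncount (e + 3) lam →
    ∀ a : V (e + 3) → ℝ≥0, ((lam.sqrt + 1 : ℕ) + 1 : ℝ≥0) ^ (e + 3)
      * (∑ u ∈ box (e + 3) (lam.sqrt + 1),
        (rep (e + 3) (lam.sqrt + 1) (lam - ∑ i, u i ^ 2) : ℝ≥0) * a u) ^ 2
      ≤ C * Ncount (e + 3) lam ^ 2 * ∑ u ∈ box (e + 3) (lam.sqrt + 1), a u ^ 2 := by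
  obtain ⟨C, hC, h⟩ := exists_sum_rep_cube_le e
  set c : ℝ := (12 * (e + 1)) ^ (2 * (e + 2)) with hc
  refine ⟨.mk (2 ^ (e + 3) * (2 * C) * c ^ 2) (by positivity), fun lam hN a => ?_⟩
  have hNR := pow_le_mul_Ncount e lam hN
  set R := lam.sqrt + 1 with hR
  have hR0 : 0 < R := Nat.succ_pos _
  have hR1 : (1 : ℝ) ≤ R := by exact_mod_cast hR0
  have hNR' : (R : ℝ) ^ (2 * (e + 2)) ≤ c * Ncount (e + 3) lam := by
    rw [hc]; exact_mod_cast hNR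
  have h1 := sum_rep_sq_le (e + 3) R lam (h R hR0)
  have h2 := sum_mul_sq_le_sq_mul_sq (box (e + 3) R)
    (fun u => (rep (e + 3) R (lam - ∑ i, u i ^ 2) : ℝ)) fun u => (a u : ℝ)
  rw [← NNReal.coe_le_coe]
  push_cast
  calc ((R : ℝ) + 1) ^ (e + 3)
        * (∑ u ∈ box (e + 3) R, (rep (e + 3) R (lam - ∑ i, u i ^ 2) : ℝ) * a u) ^ 2
      ≤ (2 ^ (e + 3) * R ^ (e + 3)) * ((2 * (C * (R : ℝ) ^ (3 * e + 5)))
          * ∑ u ∈ box (e + 3) R, (a u : ℝ) ^ 2) := by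
        have := add_one_pow_le hR1 (e + 3)
        have := h2.trans (mul_le_mul_of_nonneg_right h1 (sum_nonneg fun u _ => sq_nonneg _))
        gcongr
    _ = 2 ^ (e + 3) * (2 * C) * ((R : ℝ) ^ (2 * (e + 2))) ^ 2
          * ∑ u ∈ box (e + 3) R, (a u : ℝ) ^ 2 := by ring
    _ ≤ 2 ^ (e + 3) * (2 * C) * (c * Ncount (e + 3) lam) ^ 2
          * ∑ u ∈ box (e + 3) R, (a u : ℝ) ^ 2 := by gcongr
    _ = _ := by ring

/-- Mean estimate for the averages in dimension `e + 5`. -/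
lemma exists_sum_rep_mul_le (e : ℕ) : ∃ C : ℝ≥0, ∀ lam : ℕ, 0 < Ncount (e + 5) lam →
    ∀ a : V (e + 5) → ℝ≥0, ((lam.sqrt + 1 : ℕ) + 1 : ℝ≥0) ^ (e + 5)
      * (∑ u ∈ box (e + 5) (lam.sqrt + 1),
        (rep (e + 5) (lam.sqrt + 1) (lam - ∑ i, u i ^ 2) : ℝ≥0) * a u)
      ≤ C * Ncount (e + 5) lam * ∑ u ∈ box (e + 5) (lam.sqrt + 1), a u := by
  obtain ⟨C, hC, h⟩ := exists_rep_le e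
  set c : ℝ := (12 * ((e + 2 : ℕ) + 1)) ^ (2 * (e + 2 + 2)) with hc
  refine ⟨.mk (2 ^ (e + 5) * C * c) (by positivity), fun lam hN a => ?_⟩
  have hNR := pow_le_mul_Ncount (e + 2) lam hN
  set R := lam.sqrt + 1 with hR
  have hR0 : 0 < R := Nat.succ_pos _
  have hR1 : (1 : ℝ) ≤ R := by exact_mod_cast hR0
  have hNR' : (R : ℝ) ^ (2 * (e + 2 + 2)) ≤ c * Ncount (e + 5) lam := by
    rw [hc]; exact_mod_cast hNR
  rw [← NNReal.coe_le_coe]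
  push_cast
  calc ((R : ℝ) + 1) ^ (e + 5)
        * (∑ u ∈ box (e + 5) R, (rep (e + 5) R (lam - ∑ i, u i ^ 2) : ℝ) * a u)
      ≤ (2 ^ (e + 5) * R ^ (e + 5)) * (∑ u ∈ box (e + 5) R, C * (R : ℝ) ^ (e + 3) * a u) := by
        have := add_one_pow_le hR1 (e + 5)
        gcongr with u
        exact h R hR0 _
    _ = 2 ^ (e + 5) * C * (R : ℝ) ^ (2 * (e + 2 + 2)) * ∑ u ∈ box (e + 5) R, (a u : ℝ) := by
        rw [← mul_sum]; ring
    _ ≤ 2 ^ (e + 5) * C * (c * Ncount (e + 5) lam) * ∑ u ∈ box (e + 5) R, (a u : ℝ) := by gcongr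
    _ = _ := by ring

/-- A `q`-th mean estimate for the averages yields a pointwise domination of the bilinear
spherical maximal function by the Hardy–Littlewood maximal function. -/
lemma maxOp_pow_le (d : ℕ) {q : ℕ} (hq : 0 < q) {C : ℝ≥0}
    (h : ∀ lam : ℕ, 0 < Ncount d lam → ∀ a : V d → ℝ≥0, ((lam.sqrt + 1 : ℕ) + 1 : ℝ≥0) ^ d
      * (∑ u ∈ box d (lam.sqrt + 1),
        (rep d (lam.sqrt + 1) (lam - ∑ i, u i ^ 2) : ℝ≥0) * a u) ^ q
      ≤ C * Ncount d lam ^ q * ∑ u ∈ box d (lam.sqrt + 1), a u ^ q) (f g : V d → ℂ) (x : V d) :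
    maxOp d f g x ^ q
      ≤ C * linftyNorm d g ^ q * hlMax d (fun y => (‖f y‖₊ : ℝ≥0∞) ^ q) x := by
  have hq' : (0 : ℝ) < q := by exact_mod_cast hq
  rw [← ENNReal.rpow_natCast, ← ENNReal.le_rpow_inv_iff hq']
  refine iSup₂_le fun lam hN => ?_
  rw [ENNReal.le_rpow_inv_iff hq', ENNReal.rpow_natCast]
  have h1 : ((lam.sqrt + 1 : ℕ) + 1 : ℝ≥0∞) ^ d * (∑ u ∈ box d (lam.sqrt + 1),
        (rep d (lam.sqrt + 1) (lam - ∑ i, u i ^ 2) : ℝ≥0∞) * ‖f (x - u)‖₊) ^ q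
      ≤ C * Ncount d lam ^ q * ∑ u ∈ box d (lam.sqrt + 1), (‖f (x - u)‖₊ : ℝ≥0∞) ^ q := by
    exact_mod_cast h lam hN fun u => ‖f (x - u)‖₊
  have hR0 : ((lam.sqrt + 1 : ℕ) + 1 : ℝ≥0∞) ^ d ≠ 0 := by positivity
  have hRt : ((lam.sqrt + 1 : ℕ) + 1 : ℝ≥0∞) ^ d ≠ ∞ := ENNReal.pow_ne_top (by finiteness)
  have hN0 : (Ncount d lam : ℝ≥0∞) ^ q ≠ 0 := pow_ne_zero _ (by exact_mod_cast hN.ne')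
  have hNt : (Ncount d lam : ℝ≥0∞) ^ q ≠ ∞ := ENNReal.pow_ne_top (by finiteness)
  set N := (Ncount d lam : ℝ≥0∞) with hNdef
  set A := ∑ u ∈ box d (lam.sqrt + 1),
        (rep d (lam.sqrt + 1) (lam - ∑ i, u i ^ 2) : ℝ≥0∞) * ‖f (x - u)‖₊ with hA
  set S := ∑ u ∈ box d (lam.sqrt + 1), (‖f (x - u)‖₊ : ℝ≥0∞) ^ q with hS
  have h2 : (N ^ q)⁻¹ * A ^ q ≤ C * (S / ((lam.sqrt + 1 : ℕ) + 1 : ℝ≥0∞) ^ d) := by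
    rw [ENNReal.inv_mul_le_iff hN0 hNt, ← mul_div_assoc, ← mul_div_assoc,
      ENNReal.le_div_iff_mul_le (Or.inl hR0) (Or.inl hRt)]
    calc _ = _ := mul_comm _ _
      _ ≤ _ := h1
      _ = _ := by ring
  calc (‖avg d lam f g x‖₊ : ℝ≥0∞) ^ q ≤ (N⁻¹ * A * linftyNorm d g) ^ q := by
        gcongr
        exact nnnorm_avg_le d lam f g x
    _ = (N ^ q)⁻¹ * A ^ q * linftyNorm d g ^ q := by rw [mul_pow, mul_pow, ENNReal.inv_pow]
    _ ≤ C * (S / ((lam.sqrt + 1 : ℕ) + 1 : ℝ≥0∞) ^ d) * linftyNorm d g ^ q := by gcongr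
    _ ≤ C * hlMax d (fun y => (‖f y‖₊ : ℝ≥0∞) ^ q) x * linftyNorm d g ^ q := by
        gcongr
        exact le_iSup (fun n : ℕ => (∑ u ∈ box d n, (‖f (x - u)‖₊ : ℝ≥0∞) ^ q)
          / ((n : ℝ≥0∞) + 1) ^ d) (lam.sqrt + 1)
    _ = _ := by ring

lemma exists_lpNormE_maxOp_le (d : ℕ) {q : ℕ} (hq : 0 < q) {p : ℝ} (hp : (q : ℝ) < p) {C : ℝ≥0}
    (h : ∀ f g : V d → ℂ, ∀ x, maxOp d f g x ^ q
      ≤ C * linftyNorm d g ^ q * hlMax d (fun y => (‖f y‖₊ : ℝ≥0∞) ^ q) x) :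
    ∃ C' : ℝ≥0, ∀ f g : V d → ℂ,
      lpNormE d p (maxOp d f g) ≤ C' * lpNorm d p f * linftyNorm d g := by
  have hq' : (0 : ℝ) < q := by exact_mod_cast hq
  have hp0 : 0 < p := hq'.trans hp
  have hs : 1 < p / q := (one_lt_div hq').2 hp
  have hs0 : 0 ≤ p / q := by linarith
  have hpow : ∀ a : ℝ≥0∞, (a ^ q) ^ (p / q) = a ^ p := by
    intro a
    rw [← ENNReal.rpow_natCast, ← ENNReal.rpow_mul, mul_div_cancel₀ _ hq'.ne']
  obtain ⟨D, hD⟩ := exists_tsum_hlMax_rpow_le d hs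
  refine ⟨(C ^ (p / q) * D) ^ (1 / p), fun f g => ?_⟩
  have key : ∑' x, maxOp d f g x ^ p
      ≤ C ^ (p / q) * D * (∑' x, (‖f x‖₊ : ℝ≥0∞) ^ p) * linftyNorm d g ^ p := by
    calc ∑' x, maxOp d f g x ^ p
        ≤ ∑' x, (C * linftyNorm d g ^ q) ^ (p / q)
            * hlMax d (fun y => (‖f y‖₊ : ℝ≥0∞) ^ q) x ^ (p / q) := by
          refine ENNReal.tsum_le_tsum fun x => ?_
          rw [← hpow, ← ENNReal.mul_rpow_of_nonneg _ _ hs0]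
          exact ENNReal.rpow_le_rpow (h f g x) hs0
      _ = (C * linftyNorm d g ^ q) ^ (p / q)
            * ∑' x, hlMax d (fun y => (‖f y‖₊ : ℝ≥0∞) ^ q) x ^ (p / q) := ENNReal.tsum_mul_left
      _ ≤ (C * linftyNorm d g ^ q) ^ (p / q)
            * (D * ∑' x, ((‖f x‖₊ : ℝ≥0∞) ^ q) ^ (p / q)) := mul_le_mul_right (hD _) _
      _ = _ := by
          simp_rw [hpow]
          rw [ENNReal.mul_rpow_of_nonneg _ _ hs0, hpow]
          ring
  have hp1 : 0 ≤ 1 / p := by positivity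
  rw [lpNormE, lpNorm]
  refine (ENNReal.rpow_le_rpow key hp1).trans (le_of_eq ?_)
  rw [ENNReal.mul_rpow_of_nonneg _ _ hp1, ENNReal.mul_rpow_of_nonneg _ _ hp1,
    ← ENNReal.rpow_mul (linftyNorm d g), mul_one_div_cancel hp0.ne', ENNReal.rpow_one,
    ENNReal.coe_rpow_of_nonneg _ hp1, ENNReal.coe_mul, ENNReal.coe_rpow_of_nonneg _ hs0]

end BilinearSpherical

/-- For `d ≥ 3` and `p > d/(d-2)`, the bilinear discrete spherical maximal
operator is bounded from `l^p(ℤ^d) × l^∞(ℤ^d)` to `l^p(ℤ^d)`. -/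
theorem bilinear_discrete_spherical_lp_linfty_lp
    (d : ℕ) (hd : 3 ≤ d) (p : ℝ) (hp : (d : ℝ) / ((d : ℝ) - 2) < p) :
    ∃ C : ℝ≥0, ∀ f g : V d → ℂ,
      lpNormE d p (maxOp d f g) ≤ C * lpNorm d p f * linftyNorm d g := by
  rcases Nat.lt_or_ge d 5 with h5 | h5
  · obtain ⟨e, rfl⟩ := Nat.exists_eq_add_of_le' hd
    have hp2 : ((2 : ℕ) : ℝ) < p := by
      refine lt_of_le_of_lt ?_ hp
      have he : (e : ℝ) ≤ 1 := by exact_mod_cast (by omega : e ≤ 1)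
      have he0 : (0 : ℝ) ≤ e := by positivity
      push_cast
      rw [le_div_iff₀ (by linarith)]
      linarith
    obtain ⟨C, hC⟩ := BilinearSpherical.exists_sq_sum_rep_mul_le e
    exact BilinearSpherical.exists_lpNormE_maxOp_le _ two_pos hp2 fun f g x =>
      BilinearSpherical.maxOp_pow_le _ two_pos hC f g x
  · obtain ⟨e, rfl⟩ := Nat.exists_eq_add_of_le' h5
    have hp1 : ((1 : ℕ) : ℝ) < p := by
      refine lt_of_le_of_lt ?_ hp
      have he0 : (0 : ℝ) ≤ e := by positivity
      push_cast
      rw [le_div_iff₀ (by linarith)]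
      linarith
    obtain ⟨C, hC⟩ := BilinearSpherical.exists_sum_rep_mul_le e
    refine BilinearSpherical.exists_lpNormE_maxOp_le _ one_pos hp1 fun f g x =>
      BilinearSpherical.maxOp_pow_le _ one_pos (C := C) (fun lam hN a => ?_) f g x
    simpa using hC lam hN a
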